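/- Let F be a complete generalized isotropic Berwald metric with data (μ, λ) such that μ is a bounded function on U × (ℝ^n ∖ {0}). If F has vanishing stretch curvature (Σ_{ijkl} = 0), then F is a Landsberg metric (L_{ijk} = 0). -/

import Mathlib

/-!  Common setup: Finsler metrics on an open set `U ⊆ ℝⁿ`, in coordinates. -/

noncomputable section

open scoped BigOperators

/-- Points/vectors of `ℝⁿ`, as functions `Fin n → ℝ`. -/
abbrev Pt (n : ℕ) := Fin n → ℝ

variable {n : ℕ}

/-- Partial derivative in the fiber variable `y`, direction `yⁱ`. -/
def pdy (f : Pt n → Pt n → ℝ) (i : Fin n) : Pt n → Pt n → ℝ :=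
  fun x y => fderiv ℝ (fun y' => f x y') y (Pi.single i 1)

/-- Partial derivative in the base variable `x`, direction `xⁱ`. -/
def pdx (f : Pt n → Pt n → ℝ) (i : Fin n) : Pt n → Pt n → ℝ :=
  fun x y => fderiv ℝ (fun x' => f x' y) x (Pi.single i 1)

/-- `F²`. -/
def F2 (F : Pt n → Pt n → ℝ) : Pt n → Pt n → ℝ := fun x y => (F x y) ^ 2

/-- Fundamental tensor `g_{ij} = (1/2) ∂²(F²)/∂yⁱ∂yʲ`. -/
def gLow (F : Pt n → Pt n → ℝ) (i j : Fin n) : Pt n → Pt n → ℝ :=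
  fun x y => (1 / 2 : ℝ) * pdy (pdy (F2 F) j) i x y

/-- The fundamental tensor as a matrix. -/
def gMat (F : Pt n → Pt n → ℝ) (x y : Pt n) : Matrix (Fin n) (Fin n) ℝ :=
  Matrix.of fun i j => gLow F i j x y

/-- Inverse fundamental tensor `g^{ij}`. -/
def gInv (F : Pt n → Pt n → ℝ) (i j : Fin n) : Pt n → Pt n → ℝ :=
  fun x y => (gMat F x y)⁻¹ i j

/-- Lowered fiber variable `y_i := g_{ij} yʲ`. -/
def yLow (F : Pt n → Pt n → ℝ) (i : Fin n) : Pt n → Pt n → ℝ :=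
  fun x y => ∑ j, gLow F i j x y * y j

/-- `ℓⁱ := yⁱ / F`. -/
def ell (F : Pt n → Pt n → ℝ) (i : Fin n) : Pt n → Pt n → ℝ :=
  fun x y => y i / F x y

/-- Angular metric `h_{ij} := g_{ij} - F⁻² y_i y_j`. -/
def hLow (F : Pt n → Pt n → ℝ) (i j : Fin n) : Pt n → Pt n → ℝ :=
  fun x y => gLow F i j x y - yLow F i x y * yLow F j x y / (F x y) ^ 2

/-- `hⁱ_j := δⁱ_j - F⁻² yⁱ y_j`. -/
def hUp (F : Pt n → Pt n → ℝ) (i j : Fin n) : Pt n → Pt n → ℝ :=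
  fun x y => (if i = j then (1 : ℝ) else 0) - y i * yLow F j x y / (F x y) ^ 2

/-- Cartan torsion `C_{ijk} := (1/4) ∂³(F²)/∂yⁱ∂yʲ∂yᵏ`. -/
def Cartan (F : Pt n → Pt n → ℝ) (i j k : Fin n) : Pt n → Pt n → ℝ :=
  fun x y => (1 / 4 : ℝ) * pdy (pdy (pdy (F2 F) k) j) i x y

/-- Mean Cartan torsion `I_k := g^{ij} C_{ijk}`. -/
def mCartan (F : Pt n → Pt n → ℝ) (k : Fin n) : Pt n → Pt n → ℝ :=
  fun x y => ∑ i, ∑ j, gInv F i j x y * Cartan F i j k x y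

/-- Spray coefficients `Gⁱ`. -/
def Gspray (F : Pt n → Pt n → ℝ) (i : Fin n) : Pt n → Pt n → ℝ :=
  fun x y => (1 / 4 : ℝ) * ∑ l, gInv F i l x y *
    ((∑ k, y k * pdx (pdy (F2 F) l) k x y) - pdx (F2 F) l x y)

/-- Berwald curvature `Bⁱ_{jkl} := ∂³Gⁱ/∂yʲ∂yᵏ∂yˡ`. -/
def Bcurv (F : Pt n → Pt n → ℝ) (i j k l : Fin n) : Pt n → Pt n → ℝ :=
  pdy (pdy (pdy (Gspray F i) l) k) j

/-- Mean Berwald curvature `E_{jk} := (1/2) Bᵐ_{jkm}`. -/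
def Ecurv (F : Pt n → Pt n → ℝ) (j k : Fin n) : Pt n → Pt n → ℝ :=
  fun x y => (1 / 2 : ℝ) * ∑ m, Bcurv F m j k m x y

/-- Nonlinear connection `Nⁱ_j := ∂Gⁱ/∂yʲ`. -/
def Ncon (F : Pt n → Pt n → ℝ) (i j : Fin n) : Pt n → Pt n → ℝ :=
  pdy (Gspray F i) j

/-- Berwald connection coefficients `Γⁱ_{jk} := ∂²Gⁱ/∂yʲ∂yᵏ`. -/
def Γcon (F : Pt n → Pt n → ℝ) (i j k : Fin n) : Pt n → Pt n → ℝ :=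
  pdy (pdy (Gspray F i) k) j

/-- Horizontal (Berwald) covariant derivative of a scalar. -/
def hD0 (F : Pt n → Pt n → ℝ) (f : Pt n → Pt n → ℝ) (m : Fin n) : Pt n → Pt n → ℝ :=
  fun x y => pdx f m x y - ∑ r, Ncon F r m x y * pdy f r x y

/-- Horizontal covariant derivative of a covariant 2-tensor. -/
def hD2 (F : Pt n → Pt n → ℝ) (T : Fin n → Fin n → Pt n → Pt n → ℝ) (j k m : Fin n) :
    Pt n → Pt n → ℝ :=
  fun x y => hD0 F (T j k) m x y - (∑ r, T r k x y * Γcon F r j m x y)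
    - ∑ r, T j r x y * Γcon F r k m x y

/-- Horizontal covariant derivative of a covariant 3-tensor. -/
def hD3 (F : Pt n → Pt n → ℝ) (T : Fin n → Fin n → Fin n → Pt n → Pt n → ℝ) (i j k m : Fin n) :
    Pt n → Pt n → ℝ :=
  fun x y => hD0 F (T i j k) m x y - (∑ r, T r j k x y * Γcon F r i m x y)
    - (∑ r, T i r k x y * Γcon F r j m x y) - ∑ r, T i j r x y * Γcon F r k m x y

/-- Horizontal covariant derivative of a (1,3)-tensor `Tⁱ_{jkl}`. -/
def hD13 (F : Pt n → Pt n → ℝ) (T : Fin n → Fin n → Fin n → Fin n → Pt n → Pt n → ℝ)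
    (i j k l m : Fin n) : Pt n → Pt n → ℝ :=
  fun x y => hD0 F (T i j k l) m x y + (∑ r, T r j k l x y * Γcon F i r m x y)
    - (∑ r, T i r k l x y * Γcon F r j m x y) - (∑ r, T i j r l x y * Γcon F r k m x y)
    - ∑ r, T i j k r x y * Γcon F r l m x y

/-- Landsberg curvature `L_{ijk} := C_{ijk|m} yᵐ`. -/
def Land (F : Pt n → Pt n → ℝ) (i j k : Fin n) : Pt n → Pt n → ℝ :=
  fun x y => ∑ m, hD3 F (Cartan F) i j k m x y * y m

/-- Stretch curvature `Σ_{ijkl} := 2(L_{ijk|l} - L_{ijl|k})`. -/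
def Stretch (F : Pt n → Pt n → ℝ) (i j k l : Fin n) : Pt n → Pt n → ℝ :=
  fun x y => 2 * (hD3 F (Land F) i j k l x y - hD3 F (Land F) i j l k x y)

/-- Douglas tensor `Dⁱ_{jkl}`. -/
def Douglas (F : Pt n → Pt n → ℝ) (i j k l : Fin n) : Pt n → Pt n → ℝ :=
  fun x y => Bcurv F i j k l x y - (2 / ((n : ℝ) + 1)) *
    (Ecurv F j k x y * (if i = l then (1 : ℝ) else 0)
      + Ecurv F j l x y * (if i = k then (1 : ℝ) else 0)
      + Ecurv F k l x y * (if i = j then (1 : ℝ) else 0)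
      + pdy (Ecurv F j k) l x y * y i)

/-- Riemann curvature `Rⁱ_k`. -/
def RiemK (F : Pt n → Pt n → ℝ) (i k : Fin n) : Pt n → Pt n → ℝ :=
  fun x y => 2 * pdx (Gspray F i) k x y - (∑ j, y j * pdx (pdy (Gspray F i) k) j x y)
    + 2 * (∑ j, Gspray F j x y * Γcon F i j k x y) - ∑ j, Ncon F i j x y * Ncon F j k x y

/-- `Rⁱ_{jkl} := (1/3) ∂/∂yʲ (∂Rⁱ_k/∂yˡ - ∂Rⁱ_l/∂yᵏ)`. -/
def Riem4 (F : Pt n → Pt n → ℝ) (i j k l : Fin n) : Pt n → Pt n → ℝ :=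
  fun x y => (1 / 3 : ℝ) *
    pdy (fun x' y' => pdy (RiemK F i k) l x' y' - pdy (RiemK F i l) k x' y') j x y

/-- `F` is R-quadratic on `U`: `Rⁱ_{jkl}(x,y)` is independent of `y`. -/
def RQuadratic (U : Set (Pt n)) (F : Pt n → Pt n → ℝ) : Prop :=
  ∀ x ∈ U, ∀ y y' : Pt n, y ≠ 0 → y' ≠ 0 →
    ∀ i j k l, Riem4 F i j k l x y = Riem4 F i j k l x y'

/-- A Finsler metric on a connected open set `U ⊆ ℝⁿ` (`n ≥ 2`). -/
structure IsFinslerMetric (U : Set (Pt n)) (F : Pt n → Pt n → ℝ) : Prop where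
  dim : 2 ≤ n
  isOpen : IsOpen U
  connected : IsConnected U
  smooth : ContDiffOn ℝ (⊤ : ℕ∞) (Function.uncurry F) (U ×ˢ {y : Pt n | y ≠ 0})
  pos : ∀ x ∈ U, ∀ y : Pt n, y ≠ 0 → 0 < F x y
  homog : ∀ x ∈ U, ∀ y : Pt n, y ≠ 0 → ∀ t : ℝ, 0 < t → F x (t • y) = t * F x y
  posdef : ∀ x ∈ U, ∀ y : Pt n, y ≠ 0 → (gMat F x y).PosDef

/-- `F` is a generalized isotropic Berwald metric on `U` with data `(μ, λ)`. -/
structure IsGIB (U : Set (Pt n)) (F μ lam : Pt n → Pt n → ℝ) : Prop where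
  finsler : IsFinslerMetric U F
  smooth_mu : ContDiffOn ℝ (⊤ : ℕ∞) (Function.uncurry μ) (U ×ˢ {y : Pt n | y ≠ 0})
  smooth_lam : ContDiffOn ℝ (⊤ : ℕ∞) (Function.uncurry lam) (U ×ˢ {y : Pt n | y ≠ 0})
  homog_mu : ∀ x ∈ U, ∀ y : Pt n, y ≠ 0 → ∀ t : ℝ, 0 < t → μ x (t • y) = μ x y
  homog_lam : ∀ x ∈ U, ∀ y : Pt n, y ≠ 0 → ∀ t : ℝ, 0 < t → lam x (t • y) = t⁻¹ * lam x y
  berwald : ∀ x ∈ U, ∀ y : Pt n, y ≠ 0 → ∀ i j k l,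
    Bcurv F i j k l x y = μ x y * Cartan F j k l x y * ell F i x y
      + lam x y * (hUp F i j x y * hLow F k l x y + hUp F i k x y * hLow F j l x y
        + hUp F i l x y * hLow F j k x y)

end

noncomputable section

/-- A unit-speed geodesic of `F` contained in `U`, defined on a set `s ⊆ ℝ`. -/
structure IsUnitGeodesicOn {n : ℕ} (U : Set (Pt n)) (F : Pt n → Pt n → ℝ)
    (c : ℝ → Pt n) (s : Set ℝ) : Prop where
  mem : ∀ t ∈ s, c t ∈ U
  smooth : ContDiffOn ℝ 2 c s
  ode : ∀ t ∈ s, ∀ i, deriv (deriv c) t i + 2 * Gspray F i (c t) (deriv c t) = 0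
  unit : ∀ t ∈ s, F (c t) (deriv c t) = 1

/-- A maximal unit-speed geodesic: defined on an open interval, admitting no proper
extension to a larger open interval. -/
def IsMaximalUnitGeodesic {n : ℕ} (U : Set (Pt n)) (F : Pt n → Pt n → ℝ)
    (c : ℝ → Pt n) (s : Set ℝ) : Prop :=
  IsOpen s ∧ s.OrdConnected ∧ IsUnitGeodesicOn U F c s ∧
    ∀ (c' : ℝ → Pt n) (s' : Set ℝ), IsOpen s' → s'.OrdConnected →
      IsUnitGeodesicOn U F c' s' → s ⊆ s' → (∀ t ∈ s, c' t = c t) → s' = s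

/-- `F` is complete: every maximal unit-speed geodesic is defined on all of `ℝ`. -/
def GeodesicallyComplete {n : ℕ} (U : Set (Pt n)) (F : Pt n → Pt n → ℝ) : Prop :=
  ∀ (c : ℝ → Pt n) (s : Set ℝ), IsMaximalUnitGeodesic U F c s → s = Set.univ

end

section Calculus

variable {n : ℕ} {U : Set (Pt n)} {f g : Pt n → Pt n → ℝ}

/-- The slit tangent bundle over `U`. -/
def slit (U : Set (Pt n)) : Set (Pt n × Pt n) := U ×ˢ {y : Pt n | y ≠ 0}

lemma isOpen_slit (hU : IsOpen U) : IsOpen (slit U) := hU.prod isOpen_ne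

/-- Smoothness on the slit tangent bundle over `U`. -/
def SlitSmooth (U : Set (Pt n)) (f : Pt n → Pt n → ℝ) : Prop :=
  ContDiffOn ℝ (⊤ : ℕ∞) (Function.uncurry f) (slit U)

/-- Equality on the slit tangent bundle over `U`. -/
def SlitEq (U : Set (Pt n)) (f g : Pt n → Pt n → ℝ) : Prop :=
  ∀ x ∈ U, ∀ y : Pt n, y ≠ 0 → f x y = g x y

lemma SlitEq.pdy (h : SlitEq U f g) (i : Fin n) : SlitEq U (pdy f i) (pdy g i) := by
  intro x hx y hy
  have : (fun y' => f x y') =ᶠ[nhds y] fun y' => g x y' :=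
    Filter.eventually_of_mem (isOpen_ne.mem_nhds hy) fun y' hy' => h x hx y' hy'
  simp only [_root_.pdy, this.fderiv_eq]

lemma SlitEq.pdx (hU : IsOpen U) (h : SlitEq U f g) (i : Fin n) :
    SlitEq U (pdx f i) (pdx g i) := by
  intro x hx y hy
  have : (fun x' => f x' y) =ᶠ[nhds x] fun x' => g x' y :=
    Filter.eventually_of_mem (hU.mem_nhds hx) fun x' hx' => h x' hx' y hy
  simp only [_root_.pdx, this.fderiv_eq]

lemma SlitSmooth.congr (hf : SlitSmooth U f) (h : SlitEq U g f) : SlitSmooth U g :=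
  ContDiffOn.congr hf fun p hp => h p.1 hp.1 p.2 hp.2

lemma SlitSmooth.contDiffAt (hU : IsOpen U) (hf : SlitSmooth U f) {x y : Pt n} (hx : x ∈ U)
    (hy : y ≠ 0) : ContDiffAt ℝ (⊤ : ℕ∞) (Function.uncurry f) (x, y) :=
  ContDiffOn.contDiffAt hf ((isOpen_slit hU).mem_nhds ⟨hx, hy⟩)

lemma SlitSmooth.differentiableAt (hU : IsOpen U) (hf : SlitSmooth U f) {x y : Pt n}
    (hx : x ∈ U) (hy : y ≠ 0) : DifferentiableAt ℝ (Function.uncurry f) (x, y) :=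
  (hf.contDiffAt hU hx hy).differentiableAt (by simp)

lemma SlitSmooth.hasFDerivAt_snd (hU : IsOpen U) (hf : SlitSmooth U f) {x y : Pt n}
    (hx : x ∈ U) (hy : y ≠ 0) : HasFDerivAt (fun y' => f x y')
      ((fderiv ℝ (Function.uncurry f) (x, y)).comp (ContinuousLinearMap.inr ℝ (Pt n) (Pt n))) y :=
  (hf.differentiableAt hU hx hy).hasFDerivAt.comp y (hasFDerivAt_prodMk_right x y)

lemma SlitSmooth.hasFDerivAt_fst (hU : IsOpen U) (hf : SlitSmooth U f) {x y : Pt n}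
    (hx : x ∈ U) (hy : y ≠ 0) : HasFDerivAt (fun x' => f x' y)
      ((fderiv ℝ (Function.uncurry f) (x, y)).comp (ContinuousLinearMap.inl ℝ (Pt n) (Pt n))) x :=
  HasFDerivAt.comp (f := fun x' => (x', y)) x (hf.differentiableAt hU hx hy).hasFDerivAt
    (hasFDerivAt_prodMk_left x y)

lemma pdy_eq_fderiv (hU : IsOpen U) (hf : SlitSmooth U f) (i : Fin n) {x y : Pt n}
    (hx : x ∈ U) (hy : y ≠ 0) :
    pdy f i x y = fderiv ℝ (Function.uncurry f) (x, y) (0, Pi.single i 1) := by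
  simp [pdy, (hf.hasFDerivAt_snd hU hx hy).fderiv]

lemma pdx_eq_fderiv (hU : IsOpen U) (hf : SlitSmooth U f) (i : Fin n) {x y : Pt n}
    (hx : x ∈ U) (hy : y ≠ 0) :
    pdx f i x y = fderiv ℝ (Function.uncurry f) (x, y) (Pi.single i 1, 0) := by
  simp [pdx, (hf.hasFDerivAt_fst hU hx hy).fderiv]

lemma SlitSmooth.fderiv_apply (hU : IsOpen U) (hf : SlitSmooth U f) (v : Pt n × Pt n) :
    SlitSmooth U (fun x y => fderiv ℝ (Function.uncurry f) (x, y) v) :=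
  (ContDiffOn.fderiv_of_isOpen hf (isOpen_slit hU) (by simp)).clm_apply contDiffOn_const

lemma SlitSmooth.pdy (hU : IsOpen U) (hf : SlitSmooth U f) (i : Fin n) :
    SlitSmooth U (pdy f i) :=
  (hf.fderiv_apply hU _).congr fun _ hx _ hy => pdy_eq_fderiv hU hf i hx hy

lemma SlitSmooth.pdx (hU : IsOpen U) (hf : SlitSmooth U f) (i : Fin n) :
    SlitSmooth U (pdx f i) :=
  (hf.fderiv_apply hU _).congr fun _ hx _ hy => pdx_eq_fderiv hU hf i hx hy

lemma SlitSmooth.mul (hf : SlitSmooth U f) (hg : SlitSmooth U g) :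
    SlitSmooth U (fun x y => f x y * g x y) := ContDiffOn.mul hf hg

lemma SlitSmooth.add (hf : SlitSmooth U f) (hg : SlitSmooth U g) :
    SlitSmooth U (fun x y => f x y + g x y) := ContDiffOn.add hf hg

lemma SlitSmooth.sub (hf : SlitSmooth U f) (hg : SlitSmooth U g) :
    SlitSmooth U (fun x y => f x y - g x y) := ContDiffOn.sub hf hg

lemma slitSmooth_const (c : ℝ) : SlitSmooth U (fun _ _ => c) := contDiffOn_const

lemma SlitSmooth.const_mul (c : ℝ) (hf : SlitSmooth U f) :
    SlitSmooth U (fun x y => c * f x y) := (slitSmooth_const c).mul hf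

lemma SlitSmooth.sum {ι : Type*} {s : Finset ι} {a : ι → Pt n → Pt n → ℝ}
    (h : ∀ r, SlitSmooth U (a r)) : SlitSmooth U (fun x y => ∑ r ∈ s, a r x y) := by
  have := ContDiffOn.sum (s := s) (f := fun r => Function.uncurry (a r)) fun r _ => h r
  exact this

lemma SlitSmooth.prod {ι : Type*} {s : Finset ι} {a : ι → Pt n → Pt n → ℝ}
    (h : ∀ r, SlitSmooth U (a r)) : SlitSmooth U (fun x y => ∏ r ∈ s, a r x y) := by
  have := contDiffOn_prod (t := s) (f := fun r => Function.uncurry (a r)) fun r _ => h r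
  exact this

lemma slitSmooth_coord (k : Fin n) : SlitSmooth U (fun _ y => y k) := by
  have : ContDiff ℝ (⊤ : ℕ∞) (fun p : Pt n × Pt n => p.2 k) :=
    (contDiff_apply ℝ ℝ k).comp contDiff_snd
  exact this.contDiffOn

lemma fderiv_fderiv_apply_comm (hU : IsOpen U) (hf : SlitSmooth U f) (v w : Pt n × Pt n)
    {x y : Pt n} (hx : x ∈ U) (hy : y ≠ 0) :
    fderiv ℝ (Function.uncurry fun x y => fderiv ℝ (Function.uncurry f) (x, y) v) (x, y) w =
      fderiv ℝ (Function.uncurry fun x y => fderiv ℝ (Function.uncurry f) (x, y) w) (x, y) v := by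
  have hc := hf.contDiffAt hU hx hy
  have hd : DifferentiableAt ℝ (fderiv ℝ (Function.uncurry f)) (x, y) :=
    (hc.fderiv_right (m := 1) (WithTop.coe_le_coe.2 le_top)).differentiableAt (by simp)
  have hs : IsSymmSndFDerivAt ℝ (Function.uncurry f) (x, y) :=
    hc.isSymmSndFDerivAt (by
      rw [minSmoothness_of_isRCLikeNormedField]
      exact WithTop.coe_le_coe.2 le_top)
  have key : ∀ v w : Pt n × Pt n,
      fderiv ℝ (Function.uncurry fun x y => fderiv ℝ (Function.uncurry f) (x, y) v) (x, y) w =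
        fderiv ℝ (fderiv ℝ (Function.uncurry f)) (x, y) w v := by
    intro v w
    have := (hd.hasFDerivAt.clm_apply (hasFDerivAt_const v (x, y))).fderiv
    have e : (Function.uncurry fun x y => fderiv ℝ (Function.uncurry f) (x, y) v) =
      fun p => fderiv ℝ (Function.uncurry f) p v := rfl
    rw [e, this]
    simp
  rw [key, key]
  exact hs w v

lemma pdy_comm (hU : IsOpen U) (hf : SlitSmooth U f) (i j : Fin n) :
    SlitEq U (pdy (pdy f i) j) (pdy (pdy f j) i) := by
  have key : ∀ i : Fin n, SlitEq U (pdy f i)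
      (fun x y => fderiv ℝ (Function.uncurry f) (x, y) (0, Pi.single i 1)) :=
    fun i x hx y hy => pdy_eq_fderiv hU hf i hx hy
  intro x hx y hy
  rw [(key i).pdy j x hx y hy, (key j).pdy i x hx y hy,
    pdy_eq_fderiv hU (hf.fderiv_apply hU _) _ hx hy,
    pdy_eq_fderiv hU (hf.fderiv_apply hU _) _ hx hy, fderiv_fderiv_apply_comm hU hf _ _ hx hy]

lemma pdx_pdy_comm (hU : IsOpen U) (hf : SlitSmooth U f) (i j : Fin n) :
    SlitEq U (pdx (pdy f i) j) (pdy (pdx f j) i) := by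
  intro x hx y hy
  rw [SlitEq.pdx hU (fun x hx y hy => pdy_eq_fderiv hU hf i hx hy) j x hx y hy,
    SlitEq.pdy (fun x hx y hy => pdx_eq_fderiv hU hf j hx hy) i x hx y hy,
    pdx_eq_fderiv hU (hf.fderiv_apply hU _) _ hx hy,
    pdy_eq_fderiv hU (hf.fderiv_apply hU _) _ hx hy, fderiv_fderiv_apply_comm hU hf _ _ hx hy]

lemma pdy_add (hU : IsOpen U) (hf : SlitSmooth U f) (hg : SlitSmooth U g) (i : Fin n) :
    SlitEq U (pdy (fun x y => f x y + g x y) i) (fun x y => pdy f i x y + pdy g i x y) := by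
  intro x hx y hy
  simp only [pdy]
  rw [((hf.hasFDerivAt_snd hU hx hy).fun_add (hg.hasFDerivAt_snd hU hx hy)).fderiv,
    (hf.hasFDerivAt_snd hU hx hy).fderiv, (hg.hasFDerivAt_snd hU hx hy).fderiv]
  simp

lemma pdy_mul (hU : IsOpen U) (hf : SlitSmooth U f) (hg : SlitSmooth U g) (i : Fin n) :
    SlitEq U (pdy (fun x y => f x y * g x y) i)
      (fun x y => pdy f i x y * g x y + f x y * pdy g i x y) := by
  intro x hx y hy
  simp only [pdy]
  rw [((hf.hasFDerivAt_snd hU hx hy).fun_mul (hg.hasFDerivAt_snd hU hx hy)).fderiv,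
    (hf.hasFDerivAt_snd hU hx hy).fderiv, (hg.hasFDerivAt_snd hU hx hy).fderiv]
  simp
  ring

lemma pdx_mul (hU : IsOpen U) (hf : SlitSmooth U f) (hg : SlitSmooth U g) (i : Fin n) :
    SlitEq U (pdx (fun x y => f x y * g x y) i)
      (fun x y => pdx f i x y * g x y + f x y * pdx g i x y) := by
  intro x hx y hy
  simp only [pdx]
  rw [((hf.hasFDerivAt_fst hU hx hy).fun_mul (hg.hasFDerivAt_fst hU hx hy)).fderiv,
    (hf.hasFDerivAt_fst hU hx hy).fderiv, (hg.hasFDerivAt_fst hU hx hy).fderiv]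
  simp
  ring

lemma pdy_sum (hU : IsOpen U) {ι : Type*} {s : Finset ι} {a : ι → Pt n → Pt n → ℝ}
    (h : ∀ r, SlitSmooth U (a r)) (i : Fin n) :
    SlitEq U (pdy (fun x y => ∑ r ∈ s, a r x y) i) (fun x y => ∑ r ∈ s, pdy (a r) i x y) := by
  intro x hx y hy
  simp only [pdy]
  rw [(HasFDerivAt.fun_sum fun r _ => (h r).hasFDerivAt_snd hU hx hy).fderiv]
  simp [((h _).hasFDerivAt_snd hU hx hy).fderiv]

lemma pdx_sum (hU : IsOpen U) {ι : Type*} {s : Finset ι} {a : ι → Pt n → Pt n → ℝ}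
    (h : ∀ r, SlitSmooth U (a r)) (i : Fin n) :
    SlitEq U (pdx (fun x y => ∑ r ∈ s, a r x y) i) (fun x y => ∑ r ∈ s, pdx (a r) i x y) := by
  intro x hx y hy
  simp only [pdx]
  rw [(HasFDerivAt.fun_sum fun r _ => (h r).hasFDerivAt_fst hU hx hy).fderiv]
  simp [((h _).hasFDerivAt_fst hU hx hy).fderiv]

lemma pdy_const (c : ℝ) (i : Fin n) (x y : Pt n) : pdy (fun _ _ => c) i x y = 0 := by
  simp [pdy]

lemma pdx_const (c : ℝ) (i : Fin n) (x y : Pt n) : pdx (fun _ _ => c) i x y = 0 := by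
  simp [pdx]

lemma pdy_coord (k i : Fin n) (x y : Pt n) :
    pdy (fun _ y => y k) i x y = if k = i then 1 else 0 := by
  have : HasFDerivAt (fun y' : Pt n => y' k) (ContinuousLinearMap.proj k) y :=
    (ContinuousLinearMap.proj (R := ℝ) (φ := fun _ : Fin n => ℝ) k).hasFDerivAt
  simp [pdy, this.fderiv, Pi.single_apply]

lemma pdx_coord (k i : Fin n) (x y : Pt n) : pdx (fun _ y => y k) i x y = 0 := by
  simp [pdx]

lemma pdy_const_mul (hU : IsOpen U) (c : ℝ) (hf : SlitSmooth U f) (i : Fin n) :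
    SlitEq U (pdy (fun x y => c * f x y) i) (fun x y => c * pdy f i x y) := by
  intro x hx y hy
  simp [pdy_mul hU (slitSmooth_const c) hf i x hx y hy, pdy_const]

lemma pdx_const_mul (hU : IsOpen U) (c : ℝ) (hf : SlitSmooth U f) (i : Fin n) :
    SlitEq U (pdx (fun x y => c * f x y) i) (fun x y => c * pdx f i x y) := by
  intro x hx y hy
  simp [pdx_mul hU (slitSmooth_const c) hf i x hx y hy, pdx_const]

lemma pdy_sum_mul (hU : IsOpen U) {a b : Fin n → Pt n → Pt n → ℝ}
    (ha : ∀ r, SlitSmooth U (a r)) (hb : ∀ r, SlitSmooth U (b r)) (i : Fin n) :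
    SlitEq U (pdy (fun x y => ∑ r, a r x y * b r x y) i)
      (fun x y => ∑ r, (pdy (a r) i x y * b r x y + a r x y * pdy (b r) i x y)) := by
  intro x hx y hy
  rw [pdy_sum hU (fun r => (ha r).mul (hb r)) i x hx y hy]
  exact Finset.sum_congr rfl fun r _ => pdy_mul hU (ha r) (hb r) i x hx y hy

lemma pdy_contract (hU : IsOpen U) {a : Fin n → Pt n → Pt n → ℝ}
    (ha : ∀ r, SlitSmooth U (a r)) (i : Fin n) :
    SlitEq U (pdy (fun x y => ∑ r, y r * a r x y) i)
      (fun x y => a i x y + ∑ r, y r * pdy (a r) i x y) := by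
  intro x hx y hy
  rw [pdy_sum_mul hU slitSmooth_coord ha i x hx y hy]
  simp [pdy_coord, Finset.sum_add_distrib]

lemma pdx_contract (hU : IsOpen U) {a : Fin n → Pt n → Pt n → ℝ}
    (ha : ∀ r, SlitSmooth U (a r)) (i : Fin n) :
    SlitEq U (pdx (fun x y => ∑ r, y r * a r x y) i)
      (fun x y => ∑ r, y r * pdx (a r) i x y) := by
  intro x hx y hy
  rw [pdx_sum hU (fun r => (slitSmooth_coord r).mul (ha r)) i x hx y hy]
  refine Finset.sum_congr rfl fun r _ => ?_
  refine (pdx_mul hU (slitSmooth_coord r) (ha r) i x hx y hy).trans ?_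
  simp [pdx_coord]

/-- Euler's relation of degree `a` in the fiber variable. -/
def FiberHom (U : Set (Pt n)) (f : Pt n → Pt n → ℝ) (a : ℝ) : Prop :=
  SlitEq U (fun x y => ∑ r, y r * pdy f r x y) (fun x y => a * f x y)

lemma FiberHom.pdy (hU : IsOpen U) (hf : SlitSmooth U f) {a : ℝ} (h : FiberHom U f a)
    (l : Fin n) : FiberHom U (pdy f l) (a - 1) := by
  intro x hx y hy
  have := SlitEq.pdy h l x hx y hy
  rw [pdy_contract hU (fun r => hf.pdy hU r) l x hx y hy, pdy_const_mul hU a hf l x hx y hy] at this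
  simp only [pdy_comm hU hf l _ x hx y hy]
  linarith

lemma FiberHom.pdx (hU : IsOpen U) (hf : SlitSmooth U f) {a : ℝ} (h : FiberHom U f a)
    (l : Fin n) : FiberHom U (pdx f l) a := by
  intro x hx y hy
  have := SlitEq.pdx hU h l x hx y hy
  rw [pdx_contract hU (fun r => hf.pdy hU r) l x hx y hy, pdx_const_mul hU a hf l x hx y hy] at this
  simpa only [pdx_pdy_comm hU hf _ l x hx y hy] using this

lemma fderiv_uncurry_apply (hU : IsOpen U) (hf : SlitSmooth U f) {x y : Pt n} (hx : x ∈ U)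
    (hy : y ≠ 0) (v w : Pt n) : fderiv ℝ (Function.uncurry f) (x, y) (v, w) =
      ∑ k, v k * pdx f k x y + ∑ k, w k * pdy f k x y := by
  simp only [pdx_eq_fderiv hU hf _ hx hy, pdy_eq_fderiv hU hf _ hx hy, ← smul_eq_mul,
    ← map_smul, ← map_sum, ← map_add]
  congr 1
  ext i <;> simp [Pi.single_apply, Prod.fst_sum, Prod.snd_sum]

end Calculus

section Spray

variable {n : ℕ} {U : Set (Pt n)} {F : Pt n → Pt n → ℝ}

lemma slitSmooth_det {m : ℕ} {M : Pt n → Pt n → Matrix (Fin m) (Fin m) ℝ}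
    (h : ∀ i j, SlitSmooth U (fun x y => M x y i j)) :
    SlitSmooth U (fun x y => (M x y).det) := by
  simp only [Matrix.det_apply']
  exact SlitSmooth.sum fun σ => SlitSmooth.const_mul _ (SlitSmooth.prod fun i => h _ _)

lemma IsFinslerMetric.smooth_F2 (hF : IsFinslerMetric U F) : SlitSmooth U (F2 F) :=
  ContDiffOn.pow hF.smooth 2

lemma IsFinslerMetric.smooth_gLow (hF : IsFinslerMetric U F) (i j : Fin n) :
    SlitSmooth U (gLow F i j) :=
  ((hF.smooth_F2.pdy hF.isOpen j).pdy hF.isOpen i).const_mul _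

lemma IsFinslerMetric.smooth_gInv (hF : IsFinslerMetric U F) (i j : Fin n) :
    SlitSmooth U (gInv F i j) := by
  have hdet : SlitSmooth U (fun x y => (gMat F x y).det) :=
    slitSmooth_det fun i j => hF.smooth_gLow i j
  have hinv : SlitSmooth U (fun x y => ((gMat F x y).det)⁻¹) :=
    ContDiffOn.inv hdet fun p hp => (hF.posdef p.1 hp.1 p.2 hp.2).det_pos.ne'
  have hadj : SlitSmooth U (fun x y => (gMat F x y).adjugate i j) := by
    simp only [Matrix.adjugate_apply]
    refine slitSmooth_det fun k l => ?_
    by_cases hk : k = j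
    · subst hk
      simpa using slitSmooth_const _
    · simp only [Matrix.updateRow_apply, hk, if_false]
      exact hF.smooth_gLow k l
  refine (hinv.mul hadj).congr fun x _ y _ => ?_
  simp [gInv, Matrix.inv_def]

lemma IsFinslerMetric.smooth_Gspray (hF : IsFinslerMetric U F) (i : Fin n) :
    SlitSmooth U (Gspray F i) := by
  have hU := hF.isOpen
  have hQ := hF.smooth_F2
  exact SlitSmooth.const_mul _ (SlitSmooth.sum fun l => (hF.smooth_gInv i l).mul
    ((SlitSmooth.sum fun k => (slitSmooth_coord k).mul ((hQ.pdy hU l).pdx hU k)).sub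
      (hQ.pdx hU l)))

lemma IsFinslerMetric.smooth_Ncon (hF : IsFinslerMetric U F) (i j : Fin n) :
    SlitSmooth U (Ncon F i j) := (hF.smooth_Gspray i).pdy hF.isOpen j

lemma IsFinslerMetric.smooth_Γcon (hF : IsFinslerMetric U F) (i j k : Fin n) :
    SlitSmooth U (Γcon F i j k) := ((hF.smooth_Gspray i).pdy hF.isOpen k).pdy hF.isOpen j

lemma IsFinslerMetric.smooth_Cartan (hF : IsFinslerMetric U F) (i j k : Fin n) :
    SlitSmooth U (Cartan F i j k) :=
  (((hF.smooth_F2.pdy hF.isOpen k).pdy hF.isOpen j).pdy hF.isOpen i).const_mul _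

lemma IsFinslerMetric.fiberHom_F2 (hF : IsFinslerMetric U F) : FiberHom U (F2 F) 2 := by
  intro x hx y hy
  have h1 : HasDerivAt (fun t : ℝ => F2 F x (t • y))
      (fderiv ℝ (Function.uncurry (F2 F)) (x, y) (0, y)) 1 := by
    have h0 : HasDerivAt (fun t : ℝ => (x, t • y)) ((0 : Pt n), y) 1 := by
      simpa using (hasDerivAt_const (1 : ℝ) x).prodMk ((hasDerivAt_id (1 : ℝ)).smul_const y)
    have h2 : HasFDerivAt (Function.uncurry (F2 F))
        (fderiv ℝ (Function.uncurry (F2 F)) (x, y)) (x, (1 : ℝ) • y) := by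
      rw [one_smul]
      exact (hF.smooth_F2.differentiableAt hF.isOpen hx hy).hasFDerivAt
    exact h2.comp_hasDerivAt (1 : ℝ) h0
  have h3 : HasDerivAt (fun t : ℝ => F2 F x (t • y)) (2 * F2 F x y) 1 := by
    have h4 : HasDerivAt (fun t : ℝ => t ^ 2 * F2 F x y) (2 * F2 F x y) 1 := by
      simpa using (hasDerivAt_pow 2 (1 : ℝ)).mul_const (F2 F x y)
    refine h4.congr_of_eventuallyEq ?_
    filter_upwards [lt_mem_nhds (zero_lt_one : (0 : ℝ) < 1)] with t ht
    simp only [F2, hF.homog x hx y hy t ht]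
    ring
  have := h1.unique h3
  rw [fderiv_uncurry_apply hF.isOpen hF.smooth_F2 hx hy] at this
  simpa using this

/-- The Euler-Lagrange form of the definition of the spray. -/
lemma IsFinslerMetric.sum_Gspray_mul_hessian (hF : IsFinslerMetric U F) (l : Fin n) :
    SlitEq U (fun x y => (∑ k, y k * pdx (pdy (F2 F) l) k x y) - pdx (F2 F) l x y)
      (fun x y => 2 * ∑ r, Gspray F r x y * pdy (pdy (F2 F) l) r x y) := by
  intro x hx y hy
  set H : Fin n → ℝ := fun l => (∑ k, y k * pdx (pdy (F2 F) l) k x y) - pdx (F2 F) l x y with hH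
  have hmul : gMat F x y * (gMat F x y)⁻¹ = 1 :=
    Matrix.mul_nonsing_inv _ (hF.posdef x hx y hy).det_pos.ne'.isUnit
  have hvec : (gMat F x y).mulVec ((gMat F x y)⁻¹.mulVec H) = H := by
    rw [Matrix.mulVec_mulVec, hmul, Matrix.one_mulVec]
  have hG : ∀ r, Gspray F r x y = (1 / 4) * (gMat F x y)⁻¹.mulVec H r := fun r => rfl
  have hg : ∀ r, pdy (pdy (F2 F) l) r x y = 2 * gMat F x y l r := by
    intro r
    rw [pdy_comm hF.isOpen hF.smooth_F2 l r x hx y hy]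
    simp [gMat, gLow]
  have := congrFun hvec l
  simp only [Matrix.mulVec, dotProduct] at this
  change H l = 2 * ∑ r, Gspray F r x y * pdy (pdy (F2 F) l) r x y
  rw [← this, Finset.mul_sum]
  refine Finset.sum_congr rfl fun r _ => ?_
  rw [hG, hg]
  simp only [Matrix.mulVec, dotProduct]
  ring

/-- The spray is homogeneous of degree two. -/
lemma IsFinslerMetric.fiberHom_Gspray (hF : IsFinslerMetric U F) (i : Fin n) :
    FiberHom U (Gspray F i) 2 := by
  have hU := hF.isOpen
  have hQ := hF.smooth_F2
  have hQ1 := fun l => hQ.pdy hU l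
  have hQ2 := fun l k => (hQ1 l).pdy hU k
  have hom1 := fun l => hF.fiberHom_F2.pdy hU hQ l
  have hom2 := fun l k => (hom1 l).pdy hU (hQ1 l) k
  intro x hx y hy
  -- Euler's operator applied to the Euler-Lagrange equation
  have key : ∀ l, ∑ r, (∑ s, y s * pdy (Gspray F r) s x y) * pdy (pdy (F2 F) l) r x y =
      ∑ r, (2 * Gspray F r x y) * pdy (pdy (F2 F) l) r x y := by
    intro l
    have hEL := hF.sum_Gspray_mul_hessian l
    have hsmL : SlitSmooth U (fun x y => ∑ k, y k * pdx (pdy (F2 F) l) k x y) :=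
      SlitSmooth.sum fun k => (slitSmooth_coord k).mul ((hQ1 l).pdx hU k)
    have hL : SlitEq U (fun x y => ∑ k, y k * pdx (pdy (F2 F) l) k x y) fun x y =>
        2 * (∑ r, Gspray F r x y * pdy (pdy (F2 F) l) r x y) + pdx (F2 F) l x y :=
      fun x hx y hy => by
        have h := hEL x hx y hy
        simp only at h ⊢
        linarith
    have hsmR : SlitSmooth U (fun x y => ∑ r, Gspray F r x y * pdy (pdy (F2 F) l) r x y) :=
      SlitSmooth.sum fun r => (hF.smooth_Gspray r).mul (hQ2 l r)
    have hd : ∀ s, (pdx (pdy (F2 F) l) s x y + ∑ k, y k * pdy (pdx (pdy (F2 F) l) k) s x y) =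
        2 * (∑ r, (pdy (Gspray F r) s x y * pdy (pdy (F2 F) l) r x y
          + Gspray F r x y * pdy (pdy (pdy (F2 F) l) r) s x y)) + pdy (pdx (F2 F) l) s x y := by
      intro s
      have h := hL.pdy s x hx y hy
      rw [pdy_contract hU (fun k => (hQ1 l).pdx hU k) s x hx y hy,
        pdy_add hU (hsmR.const_mul 2) (hQ.pdx hU l) s x hx y hy] at h
      simp only [pdy_const_mul hU 2 hsmR s x hx y hy,
        pdy_sum_mul hU hF.smooth_Gspray (hQ2 l) s x hx y hy] at h
      exact h
    have hsum := Finset.sum_congr rfl fun s (_ : s ∈ Finset.univ) => congrArg (fun z => y s * z) (hd s)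
    simp only [mul_add, Finset.sum_add_distrib] at hsum
    have e1 : ∑ s, y s * ∑ k, y k * pdy (pdx (pdy (F2 F) l) k) s x y =
        ∑ k, y k * pdx (pdy (F2 F) l) k x y := by
      simp only [Finset.mul_sum]
      rw [Finset.sum_comm]
      refine Finset.sum_congr rfl fun k _ => ?_
      have h := (hom1 l).pdx hU (hQ1 l) k x hx y hy
      simp only at h
      rw [← show ((2 : ℝ) - 1) * pdx (pdy (F2 F) l) k x y = pdx (pdy (F2 F) l) k x y by ring, ← h,
        Finset.mul_sum]
      exact Finset.sum_congr rfl fun s _ => by ring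
    have e2 : ∑ s, y s * (2 * ∑ r, Gspray F r x y * pdy (pdy (pdy (F2 F) l) r) s x y) = 0 := by
      simp only [Finset.mul_sum]
      rw [Finset.sum_comm]
      refine Finset.sum_eq_zero fun r _ => ?_
      have h := hom2 l r x hx y hy
      simp only at h
      have : ∑ s, y s * (2 * (Gspray F r x y * pdy (pdy (pdy (F2 F) l) r) s x y)) =
          2 * Gspray F r x y * ∑ s, y s * pdy (pdy (pdy (F2 F) l) r) s x y := by
        rw [Finset.mul_sum]
        exact Finset.sum_congr rfl fun s _ => by ring
      rw [this, h]
      ring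
    have e3 := hF.fiberHom_F2.pdx hU hQ l x hx y hy
    have e4 : ∑ s, y s * (2 * ∑ r, pdy (Gspray F r) s x y * pdy (pdy (F2 F) l) r x y) =
        2 * ∑ r, (∑ s, y s * pdy (Gspray F r) s x y) * pdy (pdy (F2 F) l) r x y := by
      simp only [Finset.mul_sum, Finset.sum_mul]
      rw [Finset.sum_comm]
      exact Finset.sum_congr rfl fun r _ => Finset.sum_congr rfl fun s _ => by ring
    have e5 : ∑ r, (2 * Gspray F r x y) * pdy (pdy (F2 F) l) r x y =
        2 * ∑ r, Gspray F r x y * pdy (pdy (F2 F) l) r x y := by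
      rw [Finset.mul_sum]
      exact Finset.sum_congr rfl fun r _ => by ring
    have e6 := hEL x hx y hy
    simp only at e3 e6
    rw [e1, e2, e3, e4] at hsum
    rw [e5]
    linarith
  have hinj : Function.Injective (gMat F x y).mulVec :=
    Matrix.mulVec_injective_of_isUnit
      ((Matrix.isUnit_iff_isUnit_det _).2 (hF.posdef x hx y hy).det_pos.ne'.isUnit)
  refine congrFun (hinj (a₁ := fun r => ∑ s, y s * pdy (Gspray F r) s x y)
    (a₂ := fun r => 2 * Gspray F r x y) ?_) i
  ext l
  simp only [Matrix.mulVec, dotProduct]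
  have h := key l
  simp only [pdy_comm hU hQ l _ x hx y hy] at h
  simp only [gMat, Matrix.of_apply, gLow, mul_assoc, ← Finset.mul_sum]
  congr 1
  convert h using 2 with r _ r _ <;> ring

end Spray

section Landsberg

variable {n : ℕ} {U : Set (Pt n)} {F f : Pt n → Pt n → ℝ}

lemma pdy_pdy_pdy_swap (hU : IsOpen U) (hf : SlitSmooth U f) (a b c : Fin n) :
    SlitEq U (pdy (pdy (pdy f a) b) c) (pdy (pdy (pdy f b) a) c) := (pdy_comm hU hf a b).pdy c

lemma IsFinslerMetric.Cartan_swap_left (hF : IsFinslerMetric U F) (i j k : Fin n) :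
    SlitEq U (Cartan F i j k) (Cartan F j i k) := fun x hx y hy => by
  simp only [Cartan, pdy_comm hF.isOpen (hF.smooth_F2.pdy hF.isOpen k) j i x hx y hy]

lemma IsFinslerMetric.Cartan_swap_right (hF : IsFinslerMetric U F) (i j k : Fin n) :
    SlitEq U (Cartan F i j k) (Cartan F i k j) := fun x hx y hy => by
  simp only [Cartan, pdy_pdy_pdy_swap hF.isOpen hF.smooth_F2 j k i x hx y hy]

lemma IsFinslerMetric.sum_mul_Ncon (hF : IsFinslerMetric U F) (r : Fin n) :
    SlitEq U (fun x y => ∑ m, y m * Ncon F r m x y) (fun x y => 2 * Gspray F r x y) :=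
  hF.fiberHom_Gspray r

lemma IsFinslerMetric.sum_mul_Γcon_left (hF : IsFinslerMetric U F) (r j : Fin n) :
    SlitEq U (fun x y => ∑ m, y m * Γcon F r m j x y) (Ncon F r j) := fun x hx y hy => by
  have h := (hF.fiberHom_Gspray r).pdy hF.isOpen (hF.smooth_Gspray r) j x hx y hy
  simp only at h
  rw [show ((2 : ℝ) - 1) = 1 by norm_num, one_mul] at h
  exact h

lemma IsFinslerMetric.Γcon_symm (hF : IsFinslerMetric U F) (r i j : Fin n) :
    SlitEq U (Γcon F r i j) (Γcon F r j i) := pdy_comm hF.isOpen (hF.smooth_Gspray r) j i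

lemma IsFinslerMetric.sum_mul_Γcon_right (hF : IsFinslerMetric U F) (r j : Fin n) :
    SlitEq U (fun x y => ∑ m, y m * Γcon F r j m x y) (Ncon F r j) := fun x hx y hy => by
  simp only [hF.Γcon_symm r j _ x hx y hy]
  exact hF.sum_mul_Γcon_left r j x hx y hy

/-- `F²` is constant along the spray. -/
lemma IsFinslerMetric.spray_F2 (hF : IsFinslerMetric U F) :
    SlitEq U (fun x y => ∑ k, y k * pdx (F2 F) k x y)
      (fun x y => 2 * ∑ r, Gspray F r x y * pdy (F2 F) r x y) := by
  have hU := hF.isOpen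
  have hQ := hF.smooth_F2
  intro x hx y hy
  have hsum := Finset.sum_congr rfl fun l (_ : l ∈ Finset.univ) =>
    congrArg (fun z => y l * z) (hF.sum_Gspray_mul_hessian l x hx y hy)
  simp only [mul_sub, Finset.sum_sub_distrib] at hsum
  have e1 : ∑ l, y l * ∑ k, y k * pdx (pdy (F2 F) l) k x y =
      2 * ∑ k, y k * pdx (F2 F) k x y := by
    simp only [Finset.mul_sum]
    rw [Finset.sum_comm]
    refine Finset.sum_congr rfl fun k _ => ?_
    have h := hF.fiberHom_F2.pdx hU hQ k x hx y hy
    simp only at h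
    rw [mul_left_comm, ← h, Finset.mul_sum]
    refine Finset.sum_congr rfl fun l _ => ?_
    rw [pdx_pdy_comm hU hQ l k x hx y hy]
    ring
  have e2 : ∑ l, y l * (2 * ∑ r, Gspray F r x y * pdy (pdy (F2 F) l) r x y) =
      2 * ∑ r, Gspray F r x y * pdy (F2 F) r x y := by
    simp only [Finset.mul_sum]
    rw [Finset.sum_comm]
    refine Finset.sum_congr rfl fun r _ => ?_
    have h := hF.fiberHom_F2.pdy hU hQ r x hx y hy
    simp only at h
    rw [show ((2 : ℝ) - 1) = 1 by norm_num, one_mul] at h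
    rw [← h, Finset.mul_sum, Finset.mul_sum]
    refine Finset.sum_congr rfl fun l _ => ?_
    rw [pdy_comm hU hQ l r x hx y hy]
    ring
  rw [e1, e2] at hsum
  simp only
  linarith

/-- `F²` is horizontally constant. -/
lemma IsFinslerMetric.pdx_F2 (hF : IsFinslerMetric U F) (k : Fin n) :
    SlitEq U (pdx (F2 F) k) (fun x y => ∑ r, Ncon F r k x y * pdy (F2 F) r x y) := by
  have hU := hF.isOpen
  have hQ := hF.smooth_F2
  have hQ1 := fun l => hQ.pdy hU l
  intro x hx y hy
  have h := hF.spray_F2.pdy k x hx y hy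
  rw [pdy_contract hU (fun r => hQ.pdx hU r) k x hx y hy,
    pdy_const_mul hU 2 (SlitSmooth.sum fun r => (hF.smooth_Gspray r).mul (hQ1 r)) k x hx y hy] at h
  simp only [pdy_sum_mul hU hF.smooth_Gspray hQ1 k x hx y hy, Finset.sum_add_distrib] at h
  have h2 := hF.sum_Gspray_mul_hessian k x hx y hy
  simp only [pdx_pdy_comm hU hQ k _ x hx y hy, pdy_comm hU hQ k _ x hx y hy] at h2
  simp only [Ncon]
  linarith

lemma IsFinslerMetric.pdx_pdy_F2 (hF : IsFinslerMetric U F) (j k : Fin n) :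
    SlitEq U (pdx (pdy (F2 F) j) k) (fun x y => ∑ r, Γcon F r j k x y * pdy (F2 F) r x y
      + ∑ r, Ncon F r k x y * pdy (pdy (F2 F) r) j x y) := by
  have hU := hF.isOpen
  have hQ := hF.smooth_F2
  have hQ1 := fun l => hQ.pdy hU l
  intro x hx y hy
  rw [pdx_pdy_comm hU hQ j k x hx y hy, (hF.pdx_F2 k).pdy j x hx y hy,
    pdy_sum_mul hU (fun r => hF.smooth_Ncon r k) hQ1 j x hx y hy]
  simp only [Finset.sum_add_distrib]
  rfl

lemma IsFinslerMetric.pdx_pdy_pdy_F2 (hF : IsFinslerMetric U F) (i j k : Fin n) :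
    SlitEq U (pdx (pdy (pdy (F2 F) j) i) k) (fun x y =>
      ∑ r, Bcurv F r i j k x y * pdy (F2 F) r x y
      + ∑ r, Γcon F r j k x y * pdy (pdy (F2 F) r) i x y
      + ∑ r, Γcon F r i k x y * pdy (pdy (F2 F) r) j x y
      + ∑ r, Ncon F r k x y * pdy (pdy (pdy (F2 F) r) j) i x y) := by
  have hU := hF.isOpen
  have hQ := hF.smooth_F2
  have hQ1 := fun l => hQ.pdy hU l
  intro x hx y hy
  rw [pdx_pdy_comm hU (hQ1 j) i k x hx y hy, (hF.pdx_pdy_F2 j k).pdy i x hx y hy,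
    pdy_add hU (SlitSmooth.sum fun r => (hF.smooth_Γcon r j k).mul (hQ1 r))
      (SlitSmooth.sum fun r => (hF.smooth_Ncon r k).mul ((hQ1 r).pdy hU j)) i x hx y hy]
  simp only [pdy_sum_mul hU (fun r => hF.smooth_Ncon r k) (fun r => (hQ1 r).pdy hU j) i x hx y hy,
    pdy_sum_mul hU (fun r => hF.smooth_Γcon r j k) hQ1 i x hx y hy, Finset.sum_add_distrib]
  simp only [Bcurv, Γcon, Ncon]
  ring

lemma IsFinslerMetric.spray_pdy_F2 (hF : IsFinslerMetric U F) (j : Fin n) :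
    SlitEq U (fun x y => ∑ k, y k * pdx (pdy (F2 F) j) k x y) (fun x y =>
      2 * (∑ r, Gspray F r x y * pdy (pdy (F2 F) r) j x y)
      + ∑ r, Ncon F r j x y * pdy (F2 F) r x y) := by
  intro x hx y hy
  have h1 := hF.sum_Gspray_mul_hessian j x hx y hy
  have h2 := hF.pdx_F2 j x hx y hy
  simp only [pdy_comm hF.isOpen hF.smooth_F2 j _ x hx y hy] at h1 h2 ⊢
  linarith

lemma IsFinslerMetric.spray_pdy_pdy_F2 (hF : IsFinslerMetric U F) (i j : Fin n) :
    SlitEq U (fun x y => ∑ k, y k * pdx (pdy (pdy (F2 F) j) i) k x y) (fun x y =>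
      2 * (∑ r, Gspray F r x y * pdy (pdy (pdy (F2 F) r) j) i x y)
      + (∑ r, Ncon F r i x y * pdy (pdy (F2 F) r) j x y
      + ∑ r, Ncon F r j x y * pdy (pdy (F2 F) r) i x y)) := by
  have hU := hF.isOpen
  have hQ := hF.smooth_F2
  have hQ1 := fun l => hQ.pdy hU l
  have hQ2 := fun l k => (hQ1 l).pdy hU k
  intro x hx y hy
  have h := (hF.spray_pdy_F2 j).pdy i x hx y hy
  have hsm : SlitSmooth U (fun x y => ∑ r, Gspray F r x y * pdy (pdy (F2 F) r) j x y) :=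
    SlitSmooth.sum fun r => (hF.smooth_Gspray r).mul (hQ2 r j)
  rw [pdy_contract hU (fun k => (hQ1 j).pdx hU k) i x hx y hy,
    pdy_add hU (hsm.const_mul 2)
      (SlitSmooth.sum fun r => (hF.smooth_Ncon r j).mul (hQ1 r)) i x hx y hy] at h
  simp only [pdy_const_mul hU 2 hsm i x hx y hy,
    pdy_sum_mul hU hF.smooth_Gspray (fun r => hQ2 r j) i x hx y hy,
    pdy_sum_mul hU (fun r => hF.smooth_Ncon r j) hQ1 i x hx y hy,
    Finset.sum_add_distrib, hF.pdx_pdy_F2 j i x hx y hy] at h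
  simp only [pdx_pdy_comm hU (hQ1 j) i _ x hx y hy]
  have hΓ : ∑ r, pdy (Ncon F r j) i x y * pdy (F2 F) r x y =
      ∑ r, Γcon F r j i x y * pdy (F2 F) r x y :=
    Finset.sum_congr rfl fun r _ => by rw [hF.Γcon_symm r j i x hx y hy]; rfl
  have hN : ∀ r, pdy (Gspray F r) i x y = Ncon F r i x y := fun r => rfl
  simp only [hΓ, hN] at h
  linarith

lemma IsFinslerMetric.spray_pdy_pdy_pdy_F2 (hF : IsFinslerMetric U F) (i j h : Fin n) :
    SlitEq U (fun x y => ∑ k, y k * pdx (pdy (pdy (pdy (F2 F) j) i) h) k x y) (fun x y =>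
      2 * (∑ r, Gspray F r x y * pdy (pdy (pdy (pdy (F2 F) r) j) i) h x y)
      + ∑ r, Ncon F r i x y * pdy (pdy (pdy (F2 F) r) j) h x y
      + ∑ r, Ncon F r j x y * pdy (pdy (pdy (F2 F) r) i) h x y
      + ∑ r, Ncon F r h x y * pdy (pdy (pdy (F2 F) r) j) i x y
      - ∑ r, Bcurv F r i j h x y * pdy (F2 F) r x y) := by
  have hU := hF.isOpen
  have hQ := hF.smooth_F2
  have hQ1 := fun l => hQ.pdy hU l
  have hQ2 := fun l k => (hQ1 l).pdy hU k
  have hQ3 := fun l k m => (hQ2 l k).pdy hU m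
  intro x hx y hy
  have hd := (hF.spray_pdy_pdy_F2 i j).pdy h x hx y hy
  have hsm : SlitSmooth U (fun x y => ∑ r, Gspray F r x y * pdy (pdy (pdy (F2 F) r) j) i x y) :=
    SlitSmooth.sum fun r => (hF.smooth_Gspray r).mul (hQ3 r j i)
  have hsN : ∀ i j, SlitSmooth U (fun x y => ∑ r, Ncon F r i x y * pdy (pdy (F2 F) r) j x y) :=
    fun i j => SlitSmooth.sum fun r => (hF.smooth_Ncon r i).mul (hQ2 r j)
  rw [pdy_contract hU (fun k => (hQ2 j i).pdx hU k) h x hx y hy,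
    pdy_add hU (hsm.const_mul 2) ((hsN i j).add (hsN j i)) h x hx y hy] at hd
  simp only [pdy_add hU (hsN i j) (hsN j i) h x hx y hy, pdy_const_mul hU 2 hsm h x hx y hy,
    pdy_sum_mul hU hF.smooth_Gspray (fun r => hQ3 r j i) h x hx y hy,
    pdy_sum_mul hU (fun r => hF.smooth_Ncon r j) (fun r => hQ2 r i) h x hx y hy,
    pdy_sum_mul hU (fun r => hF.smooth_Ncon r i) (fun r => hQ2 r j) h x hx y hy,
    Finset.sum_add_distrib, hF.pdx_pdy_pdy_F2 i j h x hx y hy] at hd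
  simp only [pdx_pdy_comm hU (hQ2 j i) h _ x hx y hy]
  have hΓ : ∀ i j, ∑ r, pdy (Ncon F r i) h x y * pdy (pdy (F2 F) r) j x y =
      ∑ r, Γcon F r i h x y * pdy (pdy (F2 F) r) j x y := fun i j =>
    Finset.sum_congr rfl fun r _ => by rw [hF.Γcon_symm r i h x hx y hy]; rfl
  have hN : ∀ r, pdy (Gspray F r) h x y = Ncon F r h x y := fun r => rfl
  simp only [hΓ, hN] at hd
  linarith

/-- Contraction of a horizontal covariant derivative with the fiber variable. -/
lemma IsFinslerMetric.sum_hD3_mul (hF : IsFinslerMetric U F)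
    (T : Fin n → Fin n → Fin n → Pt n → Pt n → ℝ) (i j k : Fin n) :
    SlitEq U (fun x y => ∑ m, hD3 F T i j k m x y * y m) (fun x y =>
      ∑ m, y m * pdx (T i j k) m x y - 2 * (∑ r, Gspray F r x y * pdy (T i j k) r x y)
      - (∑ r, Ncon F r i x y * T r j k x y) - (∑ r, Ncon F r j x y * T i r k x y)
      - ∑ r, Ncon F r k x y * T i j r x y) := by
  intro x hx y hy
  have e0 : ∑ m, (∑ r, Ncon F r m x y * pdy (T i j k) r x y) * y m =
      2 * ∑ r, Gspray F r x y * pdy (T i j k) r x y := by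
    simp only [Finset.sum_mul, Finset.mul_sum]
    rw [Finset.sum_comm]
    refine Finset.sum_congr rfl fun r _ => ?_
    have h := hF.sum_mul_Ncon r x hx y hy
    simp only at h
    rw [← mul_assoc, ← h, Finset.sum_mul]
    exact Finset.sum_congr rfl fun m _ => by ring
  have e1 : ∀ (t : Fin n → ℝ) (i : Fin n), ∑ m, (∑ r, t r * Γcon F r i m x y) * y m =
      ∑ r, Ncon F r i x y * t r := by
    intro t i
    simp only [Finset.sum_mul]
    rw [Finset.sum_comm]
    refine Finset.sum_congr rfl fun r _ => ?_
    rw [← hF.sum_mul_Γcon_right r i x hx y hy, Finset.sum_mul]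
    exact Finset.sum_congr rfl fun m _ => by ring
  simp only [hD3, hD0, sub_mul, Finset.sum_sub_distrib, e0, e1]
  simp only [mul_comm (y _)]

/-- The Landsberg curvature in terms of the Berwald curvature: `L_{ijk} = -(1/2) y_r Bʳ_{ijk}`. -/
lemma IsFinslerMetric.Land_eq_Bcurv (hF : IsFinslerMetric U F) (i j k : Fin n) :
    SlitEq U (Land F i j k)
      (fun x y => -(1 / 4) * ∑ r, Bcurv F r j k i x y * pdy (F2 F) r x y) := by
  have hU := hF.isOpen
  have hQ := hF.smooth_F2
  have hQ1 := fun l => hQ.pdy hU l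
  have hQ2 := fun l k => (hQ1 l).pdy hU k
  have hQ3 := fun l k m => (hQ2 l k).pdy hU m
  intro x hx y hy
  have h1 := hF.sum_hD3_mul (Cartan F) i j k x hx y hy
  have h2 := hF.spray_pdy_pdy_pdy_F2 j k i x hx y hy
  have e1 : ∀ m, pdx (Cartan F i j k) m x y = 1 / 4 * pdx (pdy (pdy (pdy (F2 F) k) j) i) m x y :=
    fun m => pdx_const_mul hU (1 / 4) (hQ3 k j i) m x hx y hy
  have e2 : ∀ r, pdy (Cartan F i j k) r x y =
      1 / 4 * pdy (pdy (pdy (pdy (F2 F) r) k) j) i x y := by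
    intro r
    refine (pdy_const_mul hU (1 / 4) (hQ3 k j i) r x hx y hy).trans ?_
    beta_reduce
    rw [pdy_comm hU (hQ2 k j) i r x hx y hy, (pdy_comm hU (hQ1 k) j r).pdy i x hx y hy,
      ((pdy_comm hU hQ k r).pdy j).pdy i x hx y hy]
  have e3 : ∀ r, Cartan F r j k x y = 1 / 4 * pdy (pdy (pdy (F2 F) r) k) j x y := by
    intro r
    rw [hF.Cartan_swap_left r j k x hx y hy, hF.Cartan_swap_right j r k x hx y hy]
    rfl
  have e4 : ∀ r, Cartan F i r k x y = 1 / 4 * pdy (pdy (pdy (F2 F) r) k) i x y := by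
    intro r
    rw [hF.Cartan_swap_right i r k x hx y hy]
    rfl
  have e5 : ∀ r, Cartan F i j r x y = 1 / 4 * pdy (pdy (pdy (F2 F) r) j) i x y := fun r => rfl
  simp only [e1, e2, e3, e4, e5, mul_left_comm _ (1 / 4 : ℝ), ← Finset.mul_sum] at h1
  simp only [Land, h1]
  simp only at h2
  rw [h2]
  ring

lemma IsFinslerMetric.pdy_F2_eq_yLow (hF : IsFinslerMetric U F) (r : Fin n) :
    SlitEq U (pdy (F2 F) r) (fun x y => 2 * yLow F r x y) := by
  intro x hx y hy
  have h := hF.fiberHom_F2.pdy hF.isOpen hF.smooth_F2 r x hx y hy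
  simp only at h
  rw [show ((2 : ℝ) - 1) = 1 by norm_num, one_mul] at h
  simp only [yLow, gLow, Finset.mul_sum]
  rw [← h]
  refine Finset.sum_congr rfl fun j _ => ?_
  rw [pdy_comm hF.isOpen hF.smooth_F2 r j x hx y hy]
  ring

lemma IsGIB.Land_eq {μ lam : Pt n → Pt n → ℝ} (hF : IsGIB U F μ lam) (i j k : Fin n) :
    SlitEq U (Land F i j k) (fun x y => -(μ x y * F x y / 2) * Cartan F i j k x y) := by
  intro x hx y hy
  have hfin := hF.finsler
  have hpos := hfin.pos x hx y hy
  have hyy : ∑ r, y r * yLow F r x y = F x y ^ 2 := by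
    have h := hfin.fiberHom_F2 x hx y hy
    simp only [hfin.pdy_F2_eq_yLow _ x hx y hy, mul_left_comm _ (2 : ℝ), ← Finset.mul_sum] at h
    simpa [F2] using h
  have hℓ : ∑ r, ell F r x y * yLow F r x y = F x y := by
    simp only [ell, div_mul_eq_mul_div, ← Finset.sum_div, hyy]
    field_simp
  have hup : ∀ j, ∑ r, hUp F r j x y * yLow F r x y = 0 := by
    intro j
    simp only [hUp, sub_mul, Finset.sum_sub_distrib]
    have : ∑ r, y r * yLow F j x y / F x y ^ 2 * yLow F r x y =
        yLow F j x y / F x y ^ 2 * ∑ r, y r * yLow F r x y := by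
      rw [Finset.mul_sum]
      exact Finset.sum_congr rfl fun r _ => by ring
    rw [this, hyy]
    field_simp
    simp
  have hsplit : ∑ r, Bcurv F r j k i x y * yLow F r x y =
      μ x y * Cartan F j k i x y * (∑ r, ell F r x y * yLow F r x y)
      + lam x y * (hLow F k i x y * (∑ r, hUp F r j x y * yLow F r x y)
        + hLow F j i x y * (∑ r, hUp F r k x y * yLow F r x y)
        + hLow F j k x y * (∑ r, hUp F r i x y * yLow F r x y)) := by
    simp only [hF.berwald x hx y hy, Finset.mul_sum, ← Finset.sum_add_distrib]
    exact Finset.sum_congr rfl fun r _ => by ring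
  rw [hfin.Land_eq_Bcurv i j k x hx y hy]
  simp only [hfin.pdy_F2_eq_yLow _ x hx y hy, mul_left_comm _ (2 : ℝ), ← Finset.mul_sum]
  rw [hsplit, hℓ, hup, hup, hup, hfin.Cartan_swap_right j k i x hx y hy,
    hfin.Cartan_swap_left j i k x hx y hy]
  ring

lemma IsFinslerMetric.smooth_hD3 (hF : IsFinslerMetric U F)
    {T : Fin n → Fin n → Fin n → Pt n → Pt n → ℝ} (hT : ∀ i j k, SlitSmooth U (T i j k))
    (i j k m : Fin n) : SlitSmooth U (hD3 F T i j k m) := by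
  have hU := hF.isOpen
  exact ((((hT i j k).pdx hU m).sub (SlitSmooth.sum fun r =>
    (hF.smooth_Ncon r m).mul ((hT i j k).pdy hU r))).sub
    (SlitSmooth.sum fun r => (hT r j k).mul (hF.smooth_Γcon r i m))).sub
    (SlitSmooth.sum fun r => (hT i r k).mul (hF.smooth_Γcon r j m)) |>.sub
    (SlitSmooth.sum fun r => (hT i j r).mul (hF.smooth_Γcon r k m))

lemma IsFinslerMetric.smooth_Land (hF : IsFinslerMetric U F) (i j k : Fin n) :
    SlitSmooth U (Land F i j k) :=
  SlitSmooth.sum fun m => (hF.smooth_hD3 hF.smooth_Cartan i j k m).mul (slitSmooth_coord m)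

lemma IsFinslerMetric.sum_mul_Cartan (hF : IsFinslerMetric U F) (i j : Fin n) :
    SlitEq U (fun x y => ∑ l, y l * Cartan F i j l x y) (fun _ _ => 0) := by
  have hU := hF.isOpen
  have hQ := hF.smooth_F2
  intro x hx y hy
  have h := (hF.fiberHom_F2.pdy hU hQ j).pdy hU (hQ.pdy hU j) i x hx y hy
  simp only at h
  have e : ∀ l, Cartan F i j l x y = 1 / 4 * pdy (pdy (pdy (F2 F) j) i) l x y := fun l => by
    rw [hF.Cartan_swap_right i j l x hx y hy, hF.Cartan_swap_left i l j x hx y hy]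
    rfl
  simp only [e, mul_left_comm _ (1 / 4 : ℝ), ← Finset.mul_sum]
  rw [h]
  ring

lemma IsGIB.sum_mul_Land {μ lam : Pt n → Pt n → ℝ} (hF : IsGIB U F μ lam) (i j : Fin n) :
    SlitEq U (fun x y => ∑ l, y l * Land F i j l x y) (fun _ _ => 0) := by
  intro x hx y hy
  have h := hF.finsler.sum_mul_Cartan i j x hx y hy
  simp only at h
  simp only [hF.Land_eq i j _ x hx y hy, mul_left_comm _ (-(μ x y * F x y / 2)),
    ← Finset.mul_sum, h, mul_zero]

/-- Contraction of a horizontal covariant derivative with the fiber variable in an index in which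
the tensor is annihilated by the fiber variable. -/
lemma IsFinslerMetric.sum_hD3_mul_right_eq_zero (hF : IsFinslerMetric U F)
    {T : Fin n → Fin n → Fin n → Pt n → Pt n → ℝ} (hT : ∀ i j k, SlitSmooth U (T i j k))
    (hT0 : ∀ i j, SlitEq U (fun x y => ∑ l, y l * T i j l x y) (fun _ _ => 0)) (i j k : Fin n) :
    SlitEq U (fun x y => ∑ l, hD3 F T i j l k x y * y l) (fun _ _ => 0) := by
  have hU := hF.isOpen
  intro x hx y hy
  have ex : ∑ l, pdx (T i j l) k x y * y l = 0 := by
    have h := (hT0 i j).pdx hU k x hx y hy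
    rw [pdx_contract hU (hT i j) k x hx y hy, pdx_const] at h
    simpa only [mul_comm (y _)] using h
  have ey : ∀ r, ∑ l, pdy (T i j l) r x y * y l = - T i j r x y := fun r => by
    have h := (hT0 i j).pdy r x hx y hy
    rw [pdy_contract hU (hT i j) r x hx y hy, pdy_const] at h
    simp only [mul_comm (y _)] at h
    linarith
  have e0 : ∀ i j, ∑ l, T i j l x y * y l = 0 := fun i j => by
    have h := hT0 i j x hx y hy
    simpa only [mul_comm (y _)] using h
  have h1 : ∑ l, (∑ r, Ncon F r k x y * pdy (T i j l) r x y) * y l =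
      - ∑ r, Ncon F r k x y * T i j r x y := by
    simp only [Finset.sum_mul]
    rw [Finset.sum_comm, ← Finset.sum_neg_distrib]
    refine Finset.sum_congr rfl fun r _ => ?_
    simp only [mul_assoc, ← Finset.mul_sum, ey]
    ring
  have h2 : ∑ l, (∑ r, T r j l x y * Γcon F r i k x y) * y l = 0 := by
    simp only [Finset.sum_mul]
    rw [Finset.sum_comm]
    refine Finset.sum_eq_zero fun r _ => ?_
    simp only [mul_right_comm _ _ (y _), ← Finset.sum_mul, e0, zero_mul]
  have h3 : ∑ l, (∑ r, T i r l x y * Γcon F r j k x y) * y l = 0 := by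
    simp only [Finset.sum_mul]
    rw [Finset.sum_comm]
    refine Finset.sum_eq_zero fun r _ => ?_
    simp only [mul_right_comm _ _ (y _), ← Finset.sum_mul, e0, zero_mul]
  have h4 : ∑ l, (∑ r, T i j r x y * Γcon F r l k x y) * y l =
      ∑ r, Ncon F r k x y * T i j r x y := by
    simp only [Finset.sum_mul]
    rw [Finset.sum_comm]
    refine Finset.sum_congr rfl fun r _ => ?_
    rw [← hF.sum_mul_Γcon_left r k x hx y hy, Finset.sum_mul]
    exact Finset.sum_congr rfl fun m _ => by ring
  simp only [hD3, hD0, sub_mul, Finset.sum_sub_distrib, ex, h1, h2, h3, h4]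
  ring

/-- Under vanishing stretch curvature the Landsberg curvature is parallel along geodesics. -/
lemma IsGIB.sum_hD3_Land_mul {μ lam : Pt n → Pt n → ℝ} (hF : IsGIB U F μ lam)
    (hstretch : ∀ x ∈ U, ∀ y : Pt n, y ≠ 0 → ∀ i j k l : Fin n, Stretch F i j k l x y = 0)
    (i j k : Fin n) :
    SlitEq U (fun x y => ∑ l, hD3 F (Land F) i j k l x y * y l) (fun _ _ => 0) := by
  intro x hx y hy
  rw [← hF.finsler.sum_hD3_mul_right_eq_zero hF.finsler.smooth_Land hF.sum_mul_Land i j k x hx y hy]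
  refine Finset.sum_congr rfl fun l _ => ?_
  have h := hstretch x hx y hy i j k l
  simp only [Stretch] at h
  rw [show hD3 F (Land F) i j k l x y = hD3 F (Land F) i j l k x y by linarith]

end Landsberg

section Transport

variable {n : ℕ}

lemma eq_zero_of_norm_deriv_le_mul_norm {E : Type*} [NormedAddCommGroup E] [NormedSpace ℝ E]
    {f f' : ℝ → E} {k : ℝ → ℝ} (hk : Continuous k) (hf : ∀ t, HasDerivAt f (f' t) t)
    (hb : ∀ t, ‖f' t‖ ≤ k t * ‖f t‖) {a : ℝ} (ha : f a = 0) (b : ℝ) : f b = 0 := by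
  have forward : ∀ {f f' : ℝ → E} {k : ℝ → ℝ}, Continuous k → (∀ t, HasDerivAt f (f' t) t) →
      (∀ t, ‖f' t‖ ≤ k t * ‖f t‖) → ∀ {a b : ℝ}, f a = 0 → a ≤ b → f b = 0 := by
    intro f f' k hk hf hb a b ha hab
    obtain ⟨K, hK⟩ := (isCompact_Icc (a := a) (b := b)).bddAbove_image hk.continuousOn
    refine eq_zero_of_abs_deriv_le_mul_abs_self_of_eq_zero_right (K := K) (a := a) (b := b)
      (fun t _ => (hf t).continuousAt.continuousWithinAt) (fun t _ => (hf t).hasDerivWithinAt) ha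
      (fun t ht => (hb t).trans ?_) b ⟨hab, le_rfl⟩
    exact mul_le_mul_of_nonneg_right (hK ⟨t, ⟨ht.1, ht.2.le⟩, rfl⟩) (norm_nonneg _)
  rcases le_total a b with hab | hab
  · exact forward hk hf hb ha hab
  · have := forward (f := fun t => f (-t)) (f' := fun t => -f' (-t)) (k := fun t => k (-t))
      (a := -a) (b := -b) (hk.comp continuous_neg)
      (fun t => by simpa [Function.comp_def] using (hf (-t)).scomp t (hasDerivAt_neg t))
      (fun t => by simpa using hb (-t)) (by simpa using ha) (neg_le_neg hab)
    simpa using this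

/-- A 3-tensor along a curve which is parallel for a continuous linear connection and vanishes at
some time vanishes identically. -/
lemma parallel_eq_zero {N : ℝ → Fin n → Fin n → ℝ} (hN : ∀ r i, Continuous fun t => N t r i)
    {T : ℝ → Fin n → Fin n → Fin n → ℝ}
    (hT : ∀ t i j k, HasDerivAt (fun t => T t i j k)
      (∑ r, N t r i * T t r j k + ∑ r, N t r j * T t i r k + ∑ r, N t r k * T t i j r) t)
    {a : ℝ} (ha : T a = 0) (b : ℝ) : T b = 0 := by
  have hcont : Continuous fun t => 3 * ∑ r, ∑ i, |N t r i| := by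
    have := hN
    fun_prop
  refine eq_zero_of_norm_deriv_le_mul_norm hcont
    (fun t => hasDerivAt_pi.2 fun i => hasDerivAt_pi.2 fun j => hasDerivAt_pi.2 fun k =>
      hT t i j k) (fun t => ?_) ha b
  have hTle : ∀ i j k, |T t i j k| ≤ ‖T t‖ := fun i j k =>
    (norm_le_pi_norm (T t i j) k).trans ((norm_le_pi_norm (T t i) j).trans (norm_le_pi_norm (T t) i))
  have hsum : ∀ (i : Fin n) (u : Fin n → ℝ), (∀ r, |u r| ≤ ‖T t‖) →
      |∑ r, N t r i * u r| ≤ (∑ r, ∑ i, |N t r i|) * ‖T t‖ := by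
    intro i u hu
    refine (Finset.abs_sum_le_sum_abs _ _).trans ?_
    rw [Finset.sum_mul]
    refine Finset.sum_le_sum fun r _ => ?_
    rw [abs_mul]
    exact mul_le_mul (Finset.single_le_sum (f := fun i => |N t r i|) (fun _ _ => abs_nonneg _)
      (Finset.mem_univ i)) (hu r) (abs_nonneg _) (Finset.sum_nonneg fun _ _ => abs_nonneg _)
  have hnn : 0 ≤ (3 * ∑ r, ∑ i, |N t r i|) * ‖T t‖ := by positivity
  refine (pi_norm_le_iff_of_nonneg hnn).2 fun i => (pi_norm_le_iff_of_nonneg hnn).2 fun j =>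
    (pi_norm_le_iff_of_nonneg hnn).2 fun k => ?_
  rw [Real.norm_eq_abs]
  have h1 := hsum i (fun r => T t r j k) fun r => hTle _ _ _
  have h2 := hsum j (fun r => T t i r k) fun r => hTle _ _ _
  have h3 := hsum k (fun r => T t i j r) fun r => hTle _ _ _
  refine (abs_add_three _ _ _).trans ?_
  linarith

variable {U : Set (Pt n)} {F f : Pt n → Pt n → ℝ}

lemma SlitSmooth.hasDerivAt_comp (hU : IsOpen U) (hf : SlitSmooth U f) {c v : ℝ → Pt n}
    {w : Pt n} {t : ℝ} (hx : c t ∈ U) (hy : v t ≠ 0) (hc : HasDerivAt c (v t) t)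
    (hv : HasDerivAt v w t) : HasDerivAt (fun t => f (c t) (v t))
      (∑ k, v t k * _root_.pdx f k (c t) (v t) + ∑ k, w k * _root_.pdy f k (c t) (v t)) t := by
  rw [← fderiv_uncurry_apply hU hf hx hy]
  exact (hf.differentiableAt hU hx hy).hasFDerivAt.comp_hasDerivAt t (hc.prodMk hv)

lemma SlitSmooth.hasDerivAt_geodesic (hU : IsOpen U) (hf : SlitSmooth U f) {c v : ℝ → Pt n}
    {t : ℝ} (hx : c t ∈ U) (hy : v t ≠ 0) (hc : HasDerivAt c (v t) t)
    (hv : HasDerivAt v (fun i => -2 * Gspray F i (c t) (v t)) t) :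
    HasDerivAt (fun t => f (c t) (v t)) (∑ k, v t k * _root_.pdx f k (c t) (v t)
      - 2 * ∑ r, Gspray F r (c t) (v t) * _root_.pdy f r (c t) (v t)) t := by
  convert hf.hasDerivAt_comp hU hx hy hc hv using 1
  rw [Finset.mul_sum, sub_eq_add_neg, ← Finset.sum_neg_distrib]
  congr 1
  exact Finset.sum_congr rfl fun r _ => by ring

/-- Along a complete geodesic `C` evolves affinely with parallel slope `L`. As `L` is initially a
multiple of `C`, the Cartan torsion vanishes at some time unless `L = 0`, and `L` vanishes with
it. -/
lemma IsGIB.Land_eq_zero_of_geodesic {μ lam : Pt n → Pt n → ℝ} (hF : IsGIB U F μ lam)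
    (hstretch : ∀ x ∈ U, ∀ y : Pt n, y ≠ 0 → ∀ i j k l : Fin n, Stretch F i j k l x y = 0)
    {c v : ℝ → Pt n} (hx : ∀ t, c t ∈ U) (hy : ∀ t, v t ≠ 0) (hc : ∀ t, HasDerivAt c (v t) t)
    (hv : ∀ t, HasDerivAt v (fun i => -2 * Gspray F i (c t) (v t)) t) (i j k : Fin n) :
    Land F i j k (c 0) (v 0) = 0 := by
  have hfin := hF.finsler
  have hU := hfin.isOpen
  have hN : ∀ r i, Continuous fun t => Ncon F r i (c t) (v t) := fun r i =>
    continuous_iff_continuousAt.2 fun t => ((hfin.smooth_Ncon r i).hasDerivAt_geodesic hU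
      (hx t) (hy t) (hc t) (hv t)).continuousAt
  have hderiv : ∀ {T : Fin n → Fin n → Fin n → Pt n → Pt n → ℝ}, (∀ i j k, SlitSmooth U (T i j k)) →
      ∀ t i j k, HasDerivAt (fun t => T i j k (c t) (v t))
        (∑ m, hD3 F T i j k m (c t) (v t) * v t m
        + (∑ r, Ncon F r i (c t) (v t) * T r j k (c t) (v t)
        + ∑ r, Ncon F r j (c t) (v t) * T i r k (c t) (v t)
        + ∑ r, Ncon F r k (c t) (v t) * T i j r (c t) (v t))) t := by
    intro T hT t i j k
    convert (hT i j k).hasDerivAt_geodesic hU (hx t) (hy t) (hc t) (hv t) using 1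
    have h := hfin.sum_hD3_mul T i j k (c t) (hx t) (v t) (hy t)
    simp only at h
    rw [h]
    ring
  have hL := fun t i j k => hderiv hfin.smooth_Land t i j k
  simp only [hF.sum_hD3_Land_mul hstretch _ _ _ _ (hx _) _ (hy _), zero_add] at hL
  have hC := fun t i j k => hderiv hfin.smooth_Cartan t i j k
  have hLand := fun t i j k => hF.Land_eq i j k (c t) (hx t) (v t) (hy t)
  simp only at hLand
  set κ := μ (c 0) (v 0) * F (c 0) (v 0) / 2 with hκ
  by_cases hκ0 : κ = 0
  · rw [hLand, ← hκ, hκ0]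
    ring
  have hE : ∀ t, (fun i j k => Cartan F i j k (c t) (v t) - (t - κ⁻¹) * Land F i j k (c t) (v t))
      = (0 : Fin n → Fin n → Fin n → ℝ) := by
    refine parallel_eq_zero hN (T := fun t i j k => Cartan F i j k (c t) (v t)
      - (t - κ⁻¹) * Land F i j k (c t) (v t)) (fun t i j k => ?_) (a := 0) ?_
    · refine ((hC t i j k).fun_sub
        (((hasDerivAt_id' t).sub_const κ⁻¹).fun_mul (hL t i j k))).congr_deriv ?_
      simp only [mul_sub, Finset.sum_sub_distrib, mul_left_comm _ (t - κ⁻¹), ← Finset.mul_sum]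
      simp only [Land]
      ring
    · ext i j k
      simp only [hLand, ← hκ, Pi.zero_apply]
      field_simp
      ring
  have hL0 : (fun i j k => Land F i j k (c κ⁻¹) (v κ⁻¹)) = (0 : Fin n → Fin n → Fin n → ℝ) := by
    ext i j k
    have := congrFun (congrFun (congrFun (hE κ⁻¹) i) j) k
    simp only [sub_self, zero_mul, sub_zero, Pi.zero_apply] at this
    simp only [hLand, this, mul_zero, Pi.zero_apply]
  exact congrFun (congrFun (congrFun (parallel_eq_zero hN
    (T := fun t i j k => Land F i j k (c t) (v t)) hL hL0 0) i) j) k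

end Transport


section Geodesic

variable {n : ℕ} {U : Set (Pt n)} {F : Pt n → Pt n → ℝ}

lemma isUnitGeodesicOn_of_locally {c : ℝ → Pt n} {s : Set ℝ}
    (h : ∀ t ∈ s, ∃ (c' : ℝ → Pt n) (s' : Set ℝ), IsOpen s' ∧ t ∈ s' ∧
      IsUnitGeodesicOn U F c' s' ∧ Set.EqOn c c' s') : IsUnitGeodesicOn U F c s := by
  have key : ∀ t ∈ s, ∃ c' : ℝ → Pt n, c' t ∈ U ∧ ContDiffAt ℝ 2 c' t ∧
      (∀ i, deriv (deriv c') t i + 2 * Gspray F i (c' t) (deriv c' t) = 0) ∧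
      F (c' t) (deriv c' t) = 1 ∧ c =ᶠ[nhds t] c' := by
    intro t ht
    obtain ⟨c', s', hs', hts', hc', heq⟩ := h t ht
    have hn := hs'.mem_nhds hts'
    exact ⟨c', hc'.mem t hts', hc'.smooth.contDiffAt hn, hc'.ode t hts', hc'.unit t hts',
      heq.eventuallyEq_of_mem hn⟩
  refine ⟨fun t ht => ?_, fun t ht => ?_, fun t ht => ?_, fun t ht => ?_⟩ <;>
    obtain ⟨c', h1, h2, h3, h4, heq⟩ := key t ht
  · rwa [heq.eq_of_nhds]
  · exact (h2.congr_of_eventuallyEq heq).contDiffWithinAt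
  · rwa [heq.eq_of_nhds, heq.deriv_eq, heq.deriv.deriv_eq]
  · rwa [heq.eq_of_nhds, heq.deriv_eq]

lemma exists_maximalUnitGeodesic {c₀ : ℝ → Pt n} {s₀ : Set ℝ} (ho : IsOpen s₀)
    (hoc : s₀.OrdConnected) (hg : IsUnitGeodesicOn U F c₀ s₀) :
    ∃ (c : ℝ → Pt n) (s : Set ℝ), IsMaximalUnitGeodesic U F c s ∧ s₀ ⊆ s ∧ Set.EqOn c c₀ s₀ := by
  classical
  let X := {p : (ℝ → Pt n) × Set ℝ // IsOpen p.2 ∧ p.2.OrdConnected ∧ IsUnitGeodesicOn U F p.1 p.2 ∧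
    s₀ ⊆ p.2 ∧ Set.EqOn p.1 c₀ s₀}
  let r : X → X → Prop := fun a b => a.1.2 ⊆ b.1.2 ∧ Set.EqOn b.1.1 a.1.1 a.1.2
  have hrefl : ∀ a, r a a := fun a => ⟨subset_rfl, fun _ _ => rfl⟩
  obtain ⟨m, hm⟩ := exists_maximal_of_chains_bounded (r := r) (fun C hC => by
    rcases C.eq_empty_or_nonempty with rfl | ⟨a₀, ha₀⟩
    · exact ⟨⟨(c₀, s₀), ho, hoc, hg, subset_rfl, fun _ _ => rfl⟩, by simp⟩
    let s : Set ℝ := {t | ∃ p ∈ C, t ∈ p.1.2}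
    let c : ℝ → Pt n := fun t => if h : ∃ p ∈ C, t ∈ p.1.2 then h.choose.1.1 t else 0
    have hcomp : ∀ a ∈ C, ∀ b ∈ C, r a b ∨ r b a := fun a ha b hb => by
      by_cases hab : a = b
      · exact Or.inl (hab ▸ hrefl a)
      · exact hC ha hb hab
    have hc : ∀ p ∈ C, Set.EqOn c p.1.1 p.1.2 := by
      intro p hp t ht
      have h : ∃ p ∈ C, t ∈ p.1.2 := ⟨p, hp, ht⟩
      have h1 : c t = h.choose.1.1 t := dif_pos h
      rw [h1]
      rcases hcomp p hp _ h.choose_spec.1 with h2 | h2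
      · exact h2.2 ht
      · exact (h2.2 h.choose_spec.2).symm
    have hs : ∀ p ∈ C, p.1.2 ⊆ s := fun p hp t ht => ⟨p, hp, ht⟩
    refine ⟨⟨(c, s), ?_, ?_, ?_, ?_, ?_⟩, fun p hp => ⟨hs p hp, hc p hp⟩⟩
    · refine isOpen_iff_mem_nhds.2 fun t ⟨p, hp, ht⟩ => ?_
      exact Filter.mem_of_superset (p.2.1.mem_nhds ht) (hs p hp)
    · refine ⟨fun t ⟨p, hp, ht⟩ u ⟨q, hq, hu⟩ => ?_⟩
      rcases hcomp p hp q hq with h | h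
      · exact (q.2.2.1.out (h.1 ht) hu).trans (hs q hq)
      · exact (p.2.2.1.out ht (h.1 hu)).trans (hs p hp)
    · exact isUnitGeodesicOn_of_locally fun t ⟨p, hp, ht⟩ =>
        ⟨p.1.1, p.1.2, p.2.1, ht, p.2.2.2.1, hc p hp⟩
    · exact a₀.2.2.2.2.1.trans (hs a₀ ha₀)
    · exact ((hc a₀ ha₀).mono a₀.2.2.2.2.1).trans a₀.2.2.2.2.2)
    (fun {a b d} hab hbd => ⟨hab.1.trans hbd.1, (hbd.2.mono hab.1).trans hab.2⟩)
  refine ⟨m.1.1, m.1.2, ⟨m.2.1, m.2.2.1, m.2.2.2.1, fun c' s' ho' hoc' hg' hss heq => ?_⟩,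
    m.2.2.2.2.1, m.2.2.2.2.2⟩
  have h := hm ⟨(c', s'), ho', hoc', hg', m.2.2.2.2.1.trans hss,
    (Set.EqOn.mono m.2.2.2.2.1 heq).trans m.2.2.2.2.2⟩ ⟨hss, heq⟩
  exact h.1.antisymm hss

lemma IsFinslerMetric.exists_unitGeodesic (hF : IsFinslerMetric U F) {x y : Pt n} (hx : x ∈ U)
    (hy : y ≠ 0) (h1 : F x y = 1) : ∃ (c : ℝ → Pt n) (s : Set ℝ), IsOpen s ∧ s.OrdConnected ∧
      (0 : ℝ) ∈ s ∧ IsUnitGeodesicOn U F c s ∧ c 0 = x ∧ deriv c 0 = y := by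
  have hU := hF.isOpen
  set V : Pt n × Pt n → Pt n × Pt n := fun p => (p.2, fun i => -2 * Gspray F i p.1 p.2) with hV
  have hVs : ContDiffOn ℝ (⊤ : ℕ∞) V (slit U) :=
    contDiffOn_snd.prodMk (contDiffOn_pi.2 fun i => (hF.smooth_Gspray i).const_mul (-2))
  have hVat : ContDiffAt ℝ 1 V (x, y) :=
    (hVs.contDiffAt ((isOpen_slit hU).mem_nhds (show (x, y) ∈ slit U from ⟨hx, hy⟩))).of_le (WithTop.coe_le_coe.2 le_top)
  obtain ⟨α, hα0, ε, hε, hα⟩ :=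
    hVat.exists_forall_mem_closedBall_exists_eq_forall_mem_Ioo_hasDerivAt₀ 0
  have hmem : Set.Ioo (0 - ε) (0 + ε) ∩ α ⁻¹' slit U ∈ nhds (0 : ℝ) := by
    have h0 : (0 : ℝ) ∈ Set.Ioo (0 - ε) (0 + ε) := by constructor <;> linarith
    refine Filter.inter_mem (isOpen_Ioo.mem_nhds h0) ?_
    refine (hα 0 h0).continuousAt.preimage_mem_nhds ((isOpen_slit hU).mem_nhds ?_)
    rw [hα0]
    exact ⟨hx, hy⟩
  obtain ⟨δ, hδ, hball⟩ := Metric.mem_nhds_iff.1 hmem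
  set s := Metric.ball (0 : ℝ) δ with hs
  have hso : IsOpen s := Metric.isOpen_ball
  have hd : ∀ t ∈ s, HasDerivAt α (V (α t)) t := fun t ht => hα t (hball ht).1
  have hsl : ∀ t ∈ s, α t ∈ slit U := fun t ht => (hball ht).2
  set c : ℝ → Pt n := fun t => (α t).1 with hc
  set v : ℝ → Pt n := fun t => (α t).2 with hv
  have hdc : ∀ t ∈ s, HasDerivAt c (v t) t := fun t ht => (hd t ht).fst
  have hdv : ∀ t ∈ s, HasDerivAt v (fun i => -2 * Gspray F i (c t) (v t)) t :=
    fun t ht => (hd t ht).snd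
  have hdeq : Set.EqOn (deriv c) v s := fun t ht => (hdc t ht).deriv
  have h0s : (0 : ℝ) ∈ s := Metric.mem_ball_self hδ
  have hα1 : ContDiffOn ℝ 1 α s := by
    refine (contDiffOn_succ_iff_deriv_of_isOpen (n := 0) hso).2
      ⟨fun t ht => (hd t ht).differentiableAt.differentiableWithinAt, by simp, ?_⟩
    refine contDiffOn_zero.2 (ContinuousOn.congr (f := fun t => V (α t)) ?_
      fun t ht => (hd t ht).deriv)
    exact hVs.continuousOn.comp
      (fun t ht => (hd t ht).continuousAt.continuousWithinAt) hsl
  refine ⟨c, s, hso, (convex_ball (0 : ℝ) δ).ordConnected, h0s, ⟨?_, ?_, ?_, ?_⟩, ?_, ?_⟩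
  · exact fun t ht => (hsl t ht).1
  · refine (contDiffOn_succ_iff_deriv_of_isOpen (n := 1) hso).2
      ⟨fun t ht => (hdc t ht).differentiableAt.differentiableWithinAt, by simp, ?_⟩
    exact (contDiff_snd.comp_contDiffOn hα1).congr hdeq
  · intro t ht i
    rw [(hdeq.eventuallyEq_of_mem (hso.mem_nhds ht)).deriv_eq, (hdv t ht).deriv, hdeq ht]
    ring
  · intro t ht
    have hF2 : ∀ t ∈ s, HasDerivAt (fun t => F2 F (c t) (v t)) 0 t := by
      intro t ht
      refine (hF.smooth_F2.hasDerivAt_geodesic (c := c) (v := v) hU (hsl t ht).1 (hsl t ht).2 (hdc t ht)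
        (hdv t ht)).congr_deriv ?_
      exact sub_eq_zero.2 (hF.spray_F2 _ (hsl t ht).1 _ (hsl t ht).2)
    have hconst := hso.is_const_of_deriv_eq_zero (convex_ball (0 : ℝ) δ).isPreconnected
      (fun t ht => (hF2 t ht).differentiableAt.differentiableWithinAt)
      (fun t ht => (hF2 t ht).deriv) ht h0s
    have hpos := hF.pos _ (hsl t ht).1 _ (hsl t ht).2
    simp only [F2, hc, hv, hα0, h1] at hconst
    rw [hdeq ht]
    have hpos' : 0 < F (c t) (v t) := hpos
    have hsq : F (c t) (v t) ^ 2 = 1 ^ 2 := hconst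
    exact (sq_eq_sq₀ hpos'.le zero_le_one).1 hsq
  · simp [hc, hα0]
  · rw [hdeq h0s]
    simp [hv, hα0]

lemma IsFinslerMetric.exists_complete_unitGeodesic (hF : IsFinslerMetric U F)
    (hcomplete : GeodesicallyComplete U F) {x y : Pt n} (hx : x ∈ U) (hy : y ≠ 0)
    (h1 : F x y = 1) :
    ∃ c : ℝ → Pt n, IsUnitGeodesicOn U F c Set.univ ∧ c 0 = x ∧ deriv c 0 = y := by
  obtain ⟨c₀, s₀, ho, hoc, h0, hg, hcx, hcy⟩ := hF.exists_unitGeodesic hx hy h1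
  obtain ⟨c, s, hmax, hss, heq⟩ := exists_maximalUnitGeodesic ho hoc hg
  have hs := hcomplete c s hmax
  subst hs
  have hev : c =ᶠ[nhds 0] c₀ := heq.eventuallyEq_of_mem (ho.mem_nhds h0)
  exact ⟨c, hmax.2.2.1, hev.eq_of_nhds.trans hcx, hev.deriv_eq.trans hcy⟩

/-- `F` is small on short nonzero vectors, locally uniformly in the base point. -/
lemma IsFinslerMetric.eventually_lt_one (hF : IsFinslerMetric U F) {x : Pt n} (hx : x ∈ U) :
    ∀ᶠ p : Pt n × Pt n in nhds (x, 0), p.2 ≠ 0 → F p.1 p.2 < 1 := by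
  obtain ⟨r, hr, hrU⟩ := Metric.nhds_basis_closedBall.mem_iff.1 (hF.isOpen.mem_nhds hx)
  have hK : IsCompact (Metric.closedBall x r ×ˢ Metric.sphere (0 : Pt n) 1) :=
    (isCompact_closedBall x r).prod (isCompact_sphere 0 1)
  have hne : ∀ u ∈ Metric.sphere (0 : Pt n) 1, u ≠ 0 := by
    rintro u hu rfl
    simp at hu
  obtain ⟨M, hM⟩ := hK.bddAbove_image (f := Function.uncurry F)
    (hF.smooth.continuousOn.mono fun p hp => ⟨hrU hp.1, hne p.2 hp.2⟩)
  have hev : ∀ᶠ p : Pt n × Pt n in nhds (x, 0), ‖p.2‖ * M < 1 := by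
    have : ContinuousAt (fun p : Pt n × Pt n => ‖p.2‖ * M) (x, 0) := by fun_prop
    exact this.eventually_lt_const (by simp)
  have hev' : ∀ᶠ p : Pt n × Pt n in nhds (x, 0), p.1 ∈ Metric.closedBall x r :=
    continuousAt_fst.eventually (Metric.closedBall_mem_nhds x hr)
  filter_upwards [hev, hev'] with p hp hp' hp0
  have hn : 0 < ‖p.2‖ := norm_pos_iff.2 hp0
  have hu : ‖p.2‖⁻¹ • p.2 ∈ Metric.sphere (0 : Pt n) 1 := by
    simp [norm_smul, inv_mul_cancel₀ hn.ne']
  have h := hF.homog p.1 (hrU hp') (‖p.2‖⁻¹ • p.2) (hne _ hu) ‖p.2‖ hn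
  rw [smul_inv_smul₀ hn.ne'] at h
  rw [h]
  exact (mul_le_mul_of_nonneg_left (hM ⟨(p.1, ‖p.2‖⁻¹ • p.2), ⟨hp', hu⟩, rfl⟩) hn.le).trans_lt hp

lemma IsFinslerMetric.deriv_ne_zero_of_unitGeodesic (hF : IsFinslerMetric U F) {c : ℝ → Pt n}
    (hc : IsUnitGeodesicOn U F c Set.univ) (h0 : deriv c 0 ≠ 0) (t : ℝ) : deriv c t ≠ 0 := by
  have hc2 : ContDiff ℝ 2 c := contDiffOn_univ.1 hc.smooth
  have hcont : Continuous (deriv c) := hc2.continuous_deriv (by norm_num)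
  have hclopen : IsClopen {t | deriv c t ≠ 0} := by
    refine ⟨⟨isOpen_iff_mem_nhds.2 fun t ht => ?_⟩, isOpen_ne_fun hcont continuous_const⟩
    have ht0 : deriv c t = 0 := by simpa using ht
    have hpair : Filter.Tendsto (fun t => (c t, deriv c t)) (nhds t) (nhds (c t, 0)) := by
      rw [← ht0]
      exact (hc2.continuous.prodMk hcont).continuousAt
    filter_upwards [hpair.eventually (hF.eventually_lt_one (hc.mem t trivial))] with u hu hu0
    exact (hu hu0).ne (hc.unit u trivial)
  exact Set.eq_univ_iff_forall.1 (hclopen.eq_univ ⟨0, h0⟩) t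

lemma pdy_smul {f : Pt n → Pt n → ℝ} {x : Pt n} {t a : ℝ} (ht : t ≠ 0)
    (h : ∀ y : Pt n, y ≠ 0 → f x (t • y) = a * f x y) (i : Fin n) {y : Pt n} (hy : y ≠ 0) :
    pdy f i x (t • y) = a * t⁻¹ * pdy f i x y := by
  have hev : (fun y' => f x (t • y')) =ᶠ[nhds y] a • f x :=
    Filter.eventually_of_mem (isOpen_ne.mem_nhds hy) fun y' hy' => h y' hy'
  have h1 := hev.fderiv_eq (𝕜 := ℝ)
  rw [fderiv_comp_smul (f := f x) t, fderiv_const_smul_field] at h1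
  have h2 := DFunLike.congr_fun h1 (Pi.single i 1)
  simp only [pdy]
  simp at h2
  field_simp
  linarith

lemma IsFinslerMetric.Cartan_smul (hF : IsFinslerMetric U F) {x y : Pt n} (hx : x ∈ U)
    (hy : y ≠ 0) {t : ℝ} (ht : 0 < t) (i j k : Fin n) :
    Cartan F i j k x (t • y) = t⁻¹ * Cartan F i j k x y := by
  have h0 : ∀ y : Pt n, y ≠ 0 → F2 F x (t • y) = t ^ 2 * F2 F x y := fun y hy => by
    simp only [F2, hF.homog x hx y hy t ht]
    ring
  have h3 := pdy_smul ht.ne' (fun y hy => pdy_smul ht.ne' (fun y hy => pdy_smul ht.ne' h0 k hy)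
    j hy) i hy
  simp only [Cartan, h3]
  field_simp

end Geodesic

/-- **Theorem 2.** A complete generalized isotropic Berwald metric with bounded `μ`
and vanishing stretch curvature is a Landsberg metric. -/
theorem gib_complete_stretch_is_landsberg {n : ℕ} (U : Set (Pt n))
    (F μ lam : Pt n → Pt n → ℝ) (hF : IsGIB U F μ lam)
    (hcomplete : GeodesicallyComplete U F)
    (hbound : ∃ M : ℝ, ∀ x ∈ U, ∀ y : Pt n, y ≠ 0 → |μ x y| ≤ M)
    (hstretch : ∀ x ∈ U, ∀ y : Pt n, y ≠ 0 → ∀ i j k l : Fin n,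
      Stretch F i j k l x y = 0) :
    ∀ x ∈ U, ∀ y : Pt n, y ≠ 0 → ∀ i j k : Fin n, Land F i j k x y = 0 := by
  intro x hx y hy i j k
  have hfin := hF.finsler
  have hpos := hfin.pos x hx y hy
  have hinv := inv_pos.2 hpos
  set y₀ := (F x y)⁻¹ • y with hy₀
  have hy₀0 : y₀ ≠ 0 := smul_ne_zero hinv.ne' hy
  have hunit : F x y₀ = 1 := by
    rw [hy₀, hfin.homog x hx y hy _ hinv, inv_mul_cancel₀ hpos.ne']
  obtain ⟨c, hc, hcx, hcy⟩ := hfin.exists_complete_unitGeodesic hcomplete hx hy₀0 hunit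
  have hc2 : ContDiff ℝ 2 c := contDiffOn_univ.1 hc.smooth
  have hc1 : ContDiff ℝ 1 (deriv c) :=
    ((contDiff_succ_iff_deriv (n := 1)).1 hc2).2.2
  have hzero : Land F i j k x y₀ = 0 := by
    have h := hF.Land_eq_zero_of_geodesic hstretch (c := c) (v := deriv c)
      (fun t => hc.mem t trivial)
      (hfin.deriv_ne_zero_of_unitGeodesic hc (by rwa [hcy]))
      (fun t => (hc2.differentiable (by norm_num) t).hasDerivAt)
      (fun t => (hc1.differentiable (by norm_num) t).hasDerivAt.congr_deriv
        (funext fun i => by linarith [hc.ode t trivial i])) i j k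
    rwa [hcx, hcy] at h
  have h1 := hF.Land_eq i j k x hx y₀ hy₀0
  have h2 := hF.Land_eq i j k x hx y hy
  rw [hzero] at h1
  simp only [hy₀, hfin.Cartan_smul hx hy hinv, hfin.homog x hx y hy _ hinv,
    hF.homog_mu x hx y hy _ hinv] at h1
  rw [h2]
  field_simp at h1 ⊢
  linarith
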